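/- Let 0 ≤ γ < 1 and γ + 1 < p < 2. There exists a constant C > 0 such that for every ε > 0 and every smooth compactly supported f: ℝⁿ × ℝᵐ → ℝ, the 2-super-Poincaré inequality ∫ f² dμ ≤ ε ∫ |∇_γ f|² dμ + exp(C(1 + ε^{−p(γ+1)/(2(p−γ−1))})) (∫ |f| dμ)² holds. -/

import Mathlib

open MeasureTheory

/-- The Grushin Kaplan norm `N(x,y) = (|x|^{2(1+γ)} + (1+γ)²|y|²)^{1/(2+2γ)}` on `ℝⁿ × ℝᵐ`. -/
noncomputable def GKaplan (n m : ℕ) (γ : ℝ)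
    (w : EuclideanSpace ℝ (Fin n) × EuclideanSpace ℝ (Fin m)) : ℝ :=
  (‖w.1‖ ^ (2 * (1 + γ)) + (1 + γ) ^ 2 * ‖w.2‖ ^ 2) ^ (1 / (2 + 2 * γ))

/-- Partial derivative `∂_{x_i} f` in the `i`-th coordinate of the `x`-variable. -/
noncomputable def dX (n m : ℕ)
    (f : EuclideanSpace ℝ (Fin n) × EuclideanSpace ℝ (Fin m) → ℝ)
    (w : EuclideanSpace ℝ (Fin n) × EuclideanSpace ℝ (Fin m)) (i : Fin n) : ℝ :=
  fderiv ℝ f w (EuclideanSpace.single i (1 : ℝ), 0)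

/-- Partial derivative `∂_{y_j} f` in the `j`-th coordinate of the `y`-variable. -/
noncomputable def dY (n m : ℕ)
    (f : EuclideanSpace ℝ (Fin n) × EuclideanSpace ℝ (Fin m) → ℝ)
    (w : EuclideanSpace ℝ (Fin n) × EuclideanSpace ℝ (Fin m)) (j : Fin m) : ℝ :=
  fderiv ℝ f w (0, EuclideanSpace.single j (1 : ℝ))

/-- The squared length of the Grushin subgradient:
`|∇_γ f|² = |∇_x f|² + |x|^{2γ} |∇_y f|²`. -/
noncomputable def gradSqG (n m : ℕ) (γ : ℝ)
    (f : EuclideanSpace ℝ (Fin n) × EuclideanSpace ℝ (Fin m) → ℝ)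
    (w : EuclideanSpace ℝ (Fin n) × EuclideanSpace ℝ (Fin m)) : ℝ :=
  (∑ i, (dX n m f w i) ^ 2) + ‖w.1‖ ^ (2 * γ) * ∑ j, (dY n m f w j) ^ 2

/-- The probability measure `dμ = Z⁻¹ e^{-N^p} dξ` on `ℝⁿ × ℝᵐ` in the Grushin setting. -/
noncomputable def muG (n m : ℕ) (γ p : ℝ) :
    Measure (EuclideanSpace ℝ (Fin n) × EuclideanSpace ℝ (Fin m)) :=
  volume.withDensity (fun w => ENNReal.ofReal
    ((∫ v : EuclideanSpace ℝ (Fin n) × EuclideanSpace ℝ (Fin m),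
        Real.exp (-(GKaplan n m γ v) ^ p))⁻¹ * Real.exp (-(GKaplan n m γ w) ^ p)))

theorem integral_weight_mul_sq_le {E : Type*} [NormedAddCommGroup E] [NormedSpace ℝ E]
    [FiniteDimensional ℝ E] [MeasurableSpace E] [BorelSpace E] {μ : Measure E}
    [μ.IsAddHaarMeasure] {f U U' ψ ψ' ρ P : E → ℝ} {v : E} {C : ℝ}
    (hf : ContDiff ℝ 1 f) (hfs : HasCompactSupport f)
    (hU : Continuous U) (hU' : Continuous U') (hψ : Continuous ψ) (hψ' : Continuous ψ')
    (hρ : Continuous ρ) (hP : Continuous P) (hρ0 : ∀ w, 0 ≤ ρ w)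
    (hρv : ∀ w (t : ℝ), ρ (w + t • v) = ρ w)
    (dU : ∀ w, HasLineDerivAt ℝ U (U' w) w v) (dψ : ∀ w, HasLineDerivAt ℝ ψ (ψ' w) w v)
    (hle : ∀ w, P w ≤ ρ w * (ψ w * U' w - ψ' w - ψ w ^ 2) + C) :
    ∫ w, f w ^ 2 * P w * Real.exp (-U w) ∂μ ≤
      ∫ w, ρ w * fderiv ℝ f w v ^ 2 * Real.exp (-U w) ∂μ +
        C * ∫ w, f w ^ 2 * Real.exp (-U w) ∂μ := by
  have hfc : Continuous f := hf.continuous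
  have hdf : Continuous fun w => fderiv ℝ f w v :=
    (hf.continuous_fderiv one_ne_zero).clm_apply continuous_const
  have hdfs : HasCompactSupport fun w => fderiv ℝ f w v := hfs.fderiv_apply ℝ v
  have key : ∀ g : E → ℝ, Continuous g → Integrable (fun w => f w * g w) μ := fun g hg =>
    (hfc.mul hg).integrable_of_hasCompactSupport hfs.mul_right
  have key' : ∀ g : E → ℝ, Continuous g → Integrable (fun w => fderiv ℝ f w v * g w) μ :=
    fun g hg => (hdf.mul hg).integrable_of_hasCompactSupport hdfs.mul_right
  have ibp := integral_bilinear_hasLineDerivAt_right_eq_neg_left_of_integrable (μ := μ)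
    (B := ContinuousLinearMap.mul ℝ ℝ) (v := v)
    (f := fun w => f w ^ 2) (f' := fun w => 2 * f w * fderiv ℝ f w v)
    (g := fun w => ρ w * ψ w * Real.exp (-U w))
    (g' := fun w => ρ w * (ψ' w - ψ w * U' w) * Real.exp (-U w))
    ((key (fun w => 2 * fderiv ℝ f w v * (ρ w * ψ w * Real.exp (-U w)))
      (by fun_prop)).congr (.of_forall fun w => by simp; ring))
    ((key (fun w => f w * (ρ w * (ψ' w - ψ w * U' w) * Real.exp (-U w)))
      (by fun_prop)).congr (.of_forall fun w => by simp; ring))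
    ((key (fun w => f w * (ρ w * ψ w * Real.exp (-U w)))
      (by fun_prop)).congr (.of_forall fun w => by simp; ring))
    (fun w _ => by
      have h := ((hf.differentiable one_ne_zero w).hasFDerivAt.hasLineDerivAt v)
      have h2 := HasDerivAt.pow (n := 2) (h : HasDerivAt _ _ _)
      unfold HasLineDerivAt
      exact h2.congr_deriv (by simp))
    (fun w _ => by
      have h := HasDerivAt.mul (HasDerivAt.const_mul (ρ w) (dψ w))
        (HasDerivAt.exp (HasDerivAt.neg (dU w)))
      unfold HasLineDerivAt
      simp only [hρv]
      exact h.congr_deriv (by simp; ring))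
  simp only [ContinuousLinearMap.mul_apply'] at ibp
  rw [← integral_const_mul, ← integral_add, ← sub_nonneg]
  rotate_left
  · exact (key' (fun w => ρ w * fderiv ℝ f w v * Real.exp (-U w)) (by fun_prop)).congr
      (.of_forall fun w => by ring)
  · exact (key (fun w => C * (f w * Real.exp (-U w))) (by fun_prop)).congr
      (.of_forall fun w => by ring)
  have i1 : Integrable (fun w => ρ w * fderiv ℝ f w v ^ 2 * Real.exp (-U w) +
      C * (f w ^ 2 * Real.exp (-U w))) μ :=
    ((key' (fun w => ρ w * fderiv ℝ f w v * Real.exp (-U w)) (by fun_prop)).add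
      (key (fun w => C * (f w * Real.exp (-U w))) (by fun_prop))).congr
      (.of_forall fun w => by simp only [Pi.add_apply]; ring)
  have i2 : Integrable (fun w => f w ^ 2 * P w * Real.exp (-U w)) μ :=
    (key (fun w => f w * P w * Real.exp (-U w)) (by fun_prop)).congr
      (.of_forall fun w => by ring)
  have i3 : Integrable (fun w => f w ^ 2 * (ρ w * (ψ' w - ψ w * U' w) * Real.exp (-U w))) μ :=
    (key (fun w => f w * (ρ w * (ψ' w - ψ w * U' w) * Real.exp (-U w))) (by fun_prop)).congr
      (.of_forall fun w => by ring)
  have i4 : Integrable (fun w => 2 * f w * fderiv ℝ f w v *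
      (ρ w * ψ w * Real.exp (-U w))) μ :=
    (key (fun w => 2 * fderiv ℝ f w v * (ρ w * ψ w * Real.exp (-U w))) (by fun_prop)).congr
      (.of_forall fun w => by ring)
  rw [← integral_sub i1 i2]
  have hzero : ∫ w, (f w ^ 2 * (ρ w * (ψ' w - ψ w * U' w) * Real.exp (-U w)) +
      2 * f w * fderiv ℝ f w v * (ρ w * ψ w * Real.exp (-U w))) ∂μ = 0 := by
    rw [integral_add i3 i4, ibp]; ring
  rw [← hzero]
  refine integral_mono (i3.add i4) (i1.sub i2) fun w => ?_
  have h1 := hle w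
  have h2 := mul_nonneg (hρ0 w) (sq_nonneg (f w * ψ w - fderiv ℝ f w v))
  have h3 : 0 ≤ f w ^ 2 * (ρ w * (ψ w * U' w - ψ' w - ψ w ^ 2) + C - P w) :=
    mul_nonneg (sq_nonneg _) (by linarith)
  have h4 := mul_nonneg (add_nonneg h2 h3) (Real.exp_pos (-U w)).le
  simp only
  nlinarith [h4]

theorem sq_sub_le_integral_fderiv_sq {E : Type*} [NormedAddCommGroup E] [NormedSpace ℝ E]
    {f : E → ℝ} (hf : ContDiff ℝ 1 f) (z k : E) :
    (f (z + k) - f z) ^ 2 ≤ ∫ t in (0 : ℝ)..1, fderiv ℝ f (z + t • k) k ^ 2 := by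
  have hc : Continuous fun t : ℝ => fderiv ℝ f (z + t • k) k :=
    ((hf.continuous_fderiv one_ne_zero).comp (by fun_prop)).clm_apply continuous_const
  have h1 : ∫ t in (0 : ℝ)..1, fderiv ℝ f (z + t • k) k = f (z + k) - f z := by
    rw [intervalIntegral.integral_eq_sub_of_hasDerivAt (f := fun t : ℝ => f (z + t • k))
      (fun t _ => ?_) (hc.intervalIntegrable _ _)]
    · simp
    · have h := (hf.differentiable one_ne_zero (z + t • k)).hasFDerivAt
      have h' : HasDerivAt (fun t : ℝ => z + t • k) k t := by
        simpa using ((hasDerivAt_id t).smul_const k).const_add z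
      exact h.comp_hasDerivAt t h'
  set a := f (z + k) - f z
  have h2 : 0 ≤ ∫ t in (0 : ℝ)..1, (fderiv ℝ f (z + t • k) k - a) ^ 2 :=
    intervalIntegral.integral_nonneg zero_le_one fun t _ => sq_nonneg _
  have h3 : ∫ t in (0 : ℝ)..1, (fderiv ℝ f (z + t • k) k - a) ^ 2 =
      (∫ t in (0 : ℝ)..1, fderiv ℝ f (z + t • k) k ^ 2) - a ^ 2 := by
    have : ∀ t : ℝ, (fderiv ℝ f (z + t • k) k - a) ^ 2 =
      fderiv ℝ f (z + t • k) k ^ 2 - 2 * a * fderiv ℝ f (z + t • k) k + a ^ 2 := fun t => by ring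
    simp only [this]
    rw [intervalIntegral.integral_add, intervalIntegral.integral_sub,
      intervalIntegral.integral_const_mul, h1]
    · simp; ring
    · exact (hc.pow 2).intervalIntegrable _ _
    · exact (continuous_const.mul hc).intervalIntegrable _ _
    · exact ((hc.pow 2).sub (continuous_const.mul hc)).intervalIntegrable _ _
    · exact continuous_const.intervalIntegrable _ _
  linarith

theorem setIntegral_le_of_le_integral_segment {E : Type*} [NormedAddCommGroup E]
    [NormedSpace ℝ E] [FiniteDimensional ℝ E] [MeasurableSpace E] [BorelSpace E] {μ : Measure E}
    [μ.IsAddHaarMeasure] {F G : E → ℝ} {K : Set E} (hK : MeasurableSet K)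
    (hF : Continuous F) (hFs : HasCompactSupport F) (hF0 : ∀ w, 0 ≤ F w)
    (hG : Continuous G) (hG0 : ∀ w, 0 ≤ G w) {a k : E}
    (hGF : ∀ z ∈ K, G z ≤ ∫ t in (0 : ℝ)..1, F (z + a + t • k)) :
    ∫ z in K, G z ∂μ ≤ ∫ z, F z ∂μ := by
  have hc : ∀ z, Continuous fun t : ℝ => F (z + a + t • k) := fun z => by fun_prop
  have hFi := hF.integrable_of_hasCompactSupport (μ := μ) hFs
  rw [integral_eq_lintegral_of_nonneg_ae (.of_forall hG0) hG.aestronglyMeasurable,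
    integral_eq_lintegral_of_nonneg_ae (.of_forall hF0) hF.aestronglyMeasurable]
  refine ENNReal.toReal_mono ?_ ?_
  · exact ((hasFiniteIntegral_iff_ofReal (.of_forall hF0)).1 hFi.2).ne
  calc ∫⁻ z in K, ENNReal.ofReal (G z) ∂μ
      ≤ ∫⁻ z in K, (∫⁻ t in Set.Ioc (0 : ℝ) 1, ENNReal.ofReal (F (z + a + t • k))) ∂μ := by
        refine setLIntegral_mono' hK fun z hz => ?_
        rw [← ofReal_integral_eq_lintegral_ofReal
          ((hc z).integrableOn_Ioc) (.of_forall fun t => hF0 _)]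
        refine ENNReal.ofReal_le_ofReal ((hGF z hz).trans_eq ?_)
        rw [intervalIntegral.integral_of_le zero_le_one]
    _ ≤ ∫⁻ z, (∫⁻ t in Set.Ioc (0 : ℝ) 1, ENNReal.ofReal (F (z + a + t • k))) ∂μ :=
        setLIntegral_le_lintegral _ _
    _ = ∫⁻ t in Set.Ioc (0 : ℝ) 1, (∫⁻ z, ENNReal.ofReal (F (z + a + t • k)) ∂μ) := by
        rw [lintegral_lintegral_swap]
        have : Continuous fun p : E × ℝ => F (p.1 + a + p.2 • k) := by fun_prop
        exact this.measurable.ennreal_ofReal.aemeasurable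
    _ = ∫⁻ t in Set.Ioc (0 : ℝ) 1, (∫⁻ z, ENNReal.ofReal (F z) ∂μ) := by
        refine lintegral_congr fun t => ?_
        simp only [add_assoc]
        exact lintegral_add_right_eq_self (fun z => ENNReal.ofReal (F z)) _
    _ = ∫⁻ z, ENNReal.ofReal (F z) ∂μ := by simp

theorem exists_integral_mul_translate_le {E : Type*} [NormedAddCommGroup E]
    [NormedSpace ℝ E] [FiniteDimensional ℝ E] [MeasurableSpace E] [BorelSpace E] {μ : Measure E}
    [μ.IsAddHaarMeasure] {a : E → ℝ} (ha : Integrable a μ) (ha0 : ∀ w, 0 ≤ a w)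
    {S : Set E} (hS : μ S ≠ 0) (hS' : μ S ≠ ⊤) :
    ∃ h ∈ S, ∫ z, a z * a (z + h) ∂μ ≤ (μ.real S)⁻¹ * (∫ z, a z ∂μ) ^ 2 := by
  have hmp := measurePreserving_prod_add μ μ
  have hi0 : Integrable (fun p : E × E => a p.1 * a p.2) (μ.prod μ) := ha.mul_prod ha
  have hi : Integrable (fun p : E × E => a p.1 * a (p.1 + p.2)) (μ.prod μ) :=
    hmp.integrable_comp_of_integrable hi0
  have hint : ∫ h, ∫ z, a z * a (z + h) ∂μ ∂μ = (∫ z, a z ∂μ) ^ 2 := by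
    rw [← integral_prod_symm _ hi]
    have e := (hmp.map_eq ▸ integral_map hmp.measurable.aemeasurable
      (f := fun p : E × E => a p.1 * a p.2)
      (hmp.map_eq.symm ▸ hi0.aestronglyMeasurable) :)
    rw [← e, integral_prod_mul, sq]
  have hi2 : Integrable (fun h => ∫ z, a z * a (z + h) ∂μ) μ := hi.integral_prod_right
  obtain ⟨h, hhS, hh⟩ := exists_le_setAverage hS hS' hi2.integrableOn
  refine ⟨h, hhS, hh.trans ?_⟩
  rw [setAverage_eq, smul_eq_mul, ← hint]
  refine mul_le_mul_of_nonneg_left ?_ (by positivity)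
  exact setIntegral_le_integral hi2 (.of_forall fun h =>
    integral_nonneg fun z => mul_nonneg (ha0 _) (ha0 _))

theorem grushin_coercivity {γ q τ X y2 s u : ℝ} (hγ0 : 0 ≤ γ) (hγ1 : γ < 1)
    (hq0 : 1 / 2 < q) (hq1 : q < 1) (hpq : q * (1 + γ) ≤ 1) (hτ : τ * (1 + γ) = 2 * q - 1)
    (hX : 1 ≤ X) (hy : 0 ≤ y2)
    (hs : s ≤ X - 1) (hu : u = (1 + y2) ^ τ * s) (hu0 : 0 ≤ u) :
    (X ^ (1 + γ) + (1 + γ) ^ 2 * y2) ^ τ ≤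
      16 * ((1 + y2) ^ τ * (1 - 2 * u) / (1 + u) ^ 2) +
      1680 * ((q * (1 + γ)) ^ 2 * (X ^ (1 + γ) + (1 + γ) ^ 2 * y2) ^ (2 * q - 2) * X ^ (2 * γ) *
          (X - 1) +
        (X - 1) ^ γ * ((q * (1 + γ) ^ 2) ^ 2 *
          (X ^ (1 + γ) + (1 + γ) ^ 2 * y2) ^ (2 * q - 2) * y2)) + 21 := by
  have hqp : 0 < q := by linarith
  have hγq : 0 ≤ γ * q := mul_nonneg hγ0 hqp.le
  have hg2 : (1 + γ) ^ 2 ≤ 4 := by nlinarith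
  have hc1 : 1 / 4 ≤ (q * (1 + γ)) ^ 2 := by nlinarith
  have hc2 : 1 / 4 ≤ (q * (1 + γ) ^ 2) ^ 2 := by
    have : 1 / 2 ≤ q * (1 + γ) ^ 2 := by nlinarith
    nlinarith
  have hu4' : u ≤ 1 / 4 → 8 / 25 * (1 + u) ^ 2 ≤ 1 - 2 * u := fun h => by nlinarith
  have hτ0 : 0 < τ := by nlinarith
  have hτ1 : τ ≤ 1 := by nlinarith
  set T := X ^ (1 + γ) + (1 + γ) ^ 2 * y2 with hT
  set b := (1 + y2) ^ τ with hb
  have hX0 : 0 < X := by linarith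
  have hY : 1 ≤ 1 + y2 := by linarith
  have hY0 : 0 < 1 + y2 := by linarith
  have hXg : 1 ≤ X ^ (1 + γ) := Real.one_le_rpow hX (by linarith)
  have hT1 : 1 ≤ T := by linarith [mul_nonneg (sq_nonneg (1 + γ)) hy]
  have hT0 : 0 < T := by linarith
  have hb1 : 1 ≤ b := Real.one_le_rpow hY hτ0.le
  have hTq : 0 < T ^ (2 * q - 2) := Real.rpow_pos_of_pos hT0 _
  have hG : 0 ≤ (q * (1 + γ)) ^ 2 * T ^ (2 * q - 2) * X ^ (2 * γ) * (X - 1) :=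
    mul_nonneg (by positivity) (by linarith)
  have hH : 0 ≤ (X - 1) ^ γ * ((q * (1 + γ) ^ 2) ^ 2 * T ^ (2 * q - 2) * y2) :=
    mul_nonneg (Real.rpow_nonneg (by linarith) _) (by positivity)
  have hJ : -b ≤ b * (1 - 2 * u) / (1 + u) ^ 2 := by
    rw [le_div_iff₀ (by positivity)]
    nlinarith [mul_nonneg (by linarith : (0 : ℝ) ≤ b) (sq_nonneg u)]
  have h5 : (1 / 5 : ℝ) ≤ 5 ^ (2 * q - 2) := by
    rw [one_div, ← Real.rpow_neg_one]
    exact Real.rpow_le_rpow_of_exponent_le (by norm_num) (by linarith)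
  have h5τ : (5 : ℝ) ^ τ ≤ 5 := by
    simpa using Real.rpow_le_rpow_of_exponent_le (by norm_num : (1 : ℝ) ≤ 5) hτ1
  rcases le_total (1 + y2) (X ^ (1 + γ)) with hA | hB
  · have hT5 : T ≤ 5 * X ^ (1 + γ) := by
      linarith [mul_le_mul_of_nonneg_right hg2 hy]
    have e1 : (X ^ (1 + γ)) ^ τ = X ^ (2 * q - 1) := by
      rw [← Real.rpow_mul hX0.le, mul_comm, hτ]
    have hTτ : T ^ τ ≤ 5 * X ^ (2 * q - 1) := by
      calc T ^ τ ≤ (5 * X ^ (1 + γ)) ^ τ := Real.rpow_le_rpow hT0.le hT5 hτ0.le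
        _ = 5 ^ τ * X ^ (2 * q - 1) := by
          rw [Real.mul_rpow (by norm_num) (by positivity), e1]
        _ ≤ _ := by gcongr
    have hbX : b ≤ X ^ (2 * q - 1) := by
      rw [← e1]; exact Real.rpow_le_rpow hY0.le hA hτ0.le
    have hmon : X ^ (2 * q - 1) ≤ X ^ (2 * q * (1 + γ) - 1) :=
      Real.rpow_le_rpow_of_exponent_le hX (by linarith)
    have hTl : 1 / 5 * X ^ ((1 + γ) * (2 * q - 2)) ≤ T ^ (2 * q - 2) := by
      calc _ ≤ 5 ^ (2 * q - 2) * X ^ ((1 + γ) * (2 * q - 2)) := by gcongr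
        _ = (5 * X ^ (1 + γ)) ^ (2 * q - 2) := by
          rw [Real.mul_rpow (by norm_num) (by positivity), ← Real.rpow_mul hX0.le]
        _ ≤ _ := Real.rpow_le_rpow_of_nonpos hT0 hT5 (by linarith)
    have hGl : 1 / 20 * (X ^ (2 * q * (1 + γ) - 1) - X ^ (2 * q * (1 + γ) - 2)) ≤
        (q * (1 + γ)) ^ 2 * T ^ (2 * q - 2) * X ^ (2 * γ) * (X - 1) := by
      have e2 : X ^ (2 * q * (1 + γ) - 2) = X ^ ((1 + γ) * (2 * q - 2)) * X ^ (2 * γ) := by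
        rw [← Real.rpow_add hX0]; ring_nf
      have e3 : X ^ (2 * q * (1 + γ) - 1) = X ^ (2 * q * (1 + γ) - 2) * X := by
        rw [← Real.rpow_add_one hX0.ne']; ring_nf
      rw [e3, e2]
      calc _ = 1 / 4 * (1 / 5 * X ^ ((1 + γ) * (2 * q - 2))) * X ^ (2 * γ) * (X - 1) := by ring
        _ ≤ _ := by
          have : 0 ≤ X - 1 := by linarith
          gcongr
    have hle1 : X ^ (2 * q * (1 + γ) - 2) ≤ 1 :=
      Real.rpow_le_one_of_one_le_of_nonpos hX (by linarith)
    linarith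
  · have hT5 : T ≤ 5 * (1 + y2) := by
      linarith [mul_le_mul_of_nonneg_right hg2 hy]
    have hTτ : T ^ τ ≤ 5 * b := by
      calc T ^ τ ≤ (5 * (1 + y2)) ^ τ := Real.rpow_le_rpow hT0.le hT5 hτ0.le
        _ = 5 ^ τ * b := by rw [Real.mul_rpow (by norm_num) hY0.le]
        _ ≤ _ := by gcongr
    rcases le_or_gt u (1 / 4) with hu4 | hu4
    · have : 8 / 25 * b ≤ b * (1 - 2 * u) / (1 + u) ^ 2 := by
        rw [le_div_iff₀ (by positivity)]
        linarith [mul_le_mul_of_nonneg_left (hu4' hu4) (by linarith : 0 ≤ b)]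
      linarith
    · have hs0 : 1 / 4 * b⁻¹ ≤ X - 1 := by
        refine le_trans ?_ hs
        rw [← div_eq_mul_inv, div_le_iff₀ (by linarith)]
        linarith
      have hsg : 1 / 4 * (1 + y2) ^ (-(γ * τ)) ≤ (X - 1) ^ γ := by
        calc _ ≤ (1 / 4) ^ γ * (1 + y2) ^ (-(γ * τ)) := by
              gcongr
              simpa using Real.rpow_le_rpow_of_exponent_ge (by norm_num : (0 : ℝ) < 1 / 4)
                (by norm_num) hγ1.le
          _ = (1 / 4 * b⁻¹) ^ γ := by
              rw [Real.mul_rpow (by norm_num) (by positivity), hb, ← Real.rpow_neg hY0.le,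
                ← Real.rpow_mul hY0.le]
              ring_nf
          _ ≤ _ := Real.rpow_le_rpow (by positivity) hs0 hγ0
      have hTl : 1 / 5 * (1 + y2) ^ (2 * q - 2) ≤ T ^ (2 * q - 2) := by
        calc _ ≤ 5 ^ (2 * q - 2) * (1 + y2) ^ (2 * q - 2) := by gcongr
          _ = (5 * (1 + y2)) ^ (2 * q - 2) := by rw [Real.mul_rpow (by norm_num) hY0.le]
          _ ≤ _ := Real.rpow_le_rpow_of_nonpos hT0 hT5 (by linarith)
      have hHl : 1 / 80 * (b - (1 + y2) ^ (τ - 1)) ≤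
          (X - 1) ^ γ * ((q * (1 + γ) ^ 2) ^ 2 * T ^ (2 * q - 2) * y2) := by
        have e2 : (1 + y2) ^ (τ - 1) = (1 + y2) ^ (-(γ * τ)) * (1 + y2) ^ (2 * q - 2) := by
          rw [← Real.rpow_add hY0]; congr 1; linarith
        have e3 : b = (1 + y2) ^ (τ - 1) * (1 + y2) := by
          rw [← Real.rpow_add_one hY0.ne']; simp [hb]
        rw [e3, e2]
        calc _ = 1 / 4 * (1 + y2) ^ (-(γ * τ)) *
              (1 / 4 * (1 / 5 * (1 + y2) ^ (2 * q - 2)) * y2) := by ring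
          _ ≤ _ := by gcongr
      have hle1 : (1 + y2) ^ (τ - 1) ≤ 1 :=
        Real.rpow_le_one_of_one_le_of_nonpos hY (by linarith)
      linarith

instance (n m : ℕ) : (volume : Measure (EuclideanSpace ℝ (Fin n) ×
    EuclideanSpace ℝ (Fin m))).IsAddHaarMeasure :=
  inferInstanceAs (Measure.prod volume volume).IsAddHaarMeasure

/-- The regularised gauge `1 + |x|²`. -/
noncomputable def grushinX {n m : ℕ} (w : EuclideanSpace ℝ (Fin n) × EuclideanSpace ℝ (Fin m)) :
    ℝ := 1 + ‖w.1‖ ^ 2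

/-- The regularised gauge `(1 + |x|²)^{1+γ} + (1+γ)²|y|²`, comparable with `1 + N^{2+2γ}`. -/
noncomputable def grushinT {n m : ℕ} (γ : ℝ)
    (w : EuclideanSpace ℝ (Fin n) × EuclideanSpace ℝ (Fin m)) : ℝ :=
  grushinX w ^ (1 + γ) + (1 + γ) ^ 2 * ‖w.2‖ ^ 2

section Gauge

variable {n m : ℕ} {γ q : ℝ}

theorem one_le_grushinX (w : EuclideanSpace ℝ (Fin n) × EuclideanSpace ℝ (Fin m)) :
    1 ≤ grushinX w := by
  unfold grushinX; nlinarith [sq_nonneg ‖w.1‖]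

theorem grushinX_pos (w : EuclideanSpace ℝ (Fin n) × EuclideanSpace ℝ (Fin m)) :
    0 < grushinX w := one_pos.trans_le (one_le_grushinX w)

theorem rpow_grushinX_le_grushinT (w : EuclideanSpace ℝ (Fin n) × EuclideanSpace ℝ (Fin m)) :
    grushinX w ^ (1 + γ) ≤ grushinT γ w :=
  le_add_of_nonneg_right (by positivity)

theorem one_le_grushinT (hγ0 : 0 ≤ γ)
    (w : EuclideanSpace ℝ (Fin n) × EuclideanSpace ℝ (Fin m)) : 1 ≤ grushinT γ w :=
  (Real.one_le_rpow (one_le_grushinX w) (by linarith)).trans (rpow_grushinX_le_grushinT w)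

theorem grushinT_pos (hγ0 : 0 ≤ γ)
    (w : EuclideanSpace ℝ (Fin n) × EuclideanSpace ℝ (Fin m)) : 0 < grushinT γ w :=
  one_pos.trans_le (one_le_grushinT hγ0 w)

theorem continuous_grushinX :
    Continuous (grushinX : EuclideanSpace ℝ (Fin n) × EuclideanSpace ℝ (Fin m) → ℝ) := by
  unfold grushinX; fun_prop

theorem continuous_grushinX_rpow (a : ℝ) : Continuous fun w :
    EuclideanSpace ℝ (Fin n) × EuclideanSpace ℝ (Fin m) => grushinX w ^ a :=
  continuous_grushinX.rpow_const fun w => .inl (grushinX_pos w).ne'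

theorem continuous_grushinT :
    Continuous (grushinT γ : EuclideanSpace ℝ (Fin n) × EuclideanSpace ℝ (Fin m) → ℝ) := by
  have := continuous_grushinX_rpow (n := n) (m := m) (1 + γ)
  unfold grushinT; fun_prop

theorem continuous_grushinT_rpow (hγ0 : 0 ≤ γ) (a : ℝ) : Continuous fun w :
    EuclideanSpace ℝ (Fin n) × EuclideanSpace ℝ (Fin m) => grushinT γ w ^ a :=
  continuous_grushinT.rpow_const fun w => .inl (grushinT_pos hγ0 w).ne'

theorem hasLineDerivAt_grushinX
    (w v : EuclideanSpace ℝ (Fin n) × EuclideanSpace ℝ (Fin m)) :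
    HasLineDerivAt ℝ grushinX (2 * inner ℝ w.1 v.1) w v := by
  have h : HasDerivAt (fun t : ℝ => w.1 + t • v.1) v.1 0 := by
    simpa using ((hasDerivAt_id (0 : ℝ)).smul_const v.1).const_add w.1
  have := h.norm_sq.const_add 1
  exact this.congr_deriv (by simp)

theorem hasLineDerivAt_grushinX_rpow (a : ℝ)
    (w v : EuclideanSpace ℝ (Fin n) × EuclideanSpace ℝ (Fin m)) :
    HasLineDerivAt ℝ (fun w => grushinX w ^ a)
      (2 * inner ℝ w.1 v.1 * a * grushinX w ^ (a - 1)) w v := by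
  have := HasDerivAt.rpow_const (p := a) (hasLineDerivAt_grushinX w v)
    (.inl (grushinX_pos _).ne')
  exact this.congr_deriv (by simp)

theorem hasLineDerivAt_grushinT
    (w v : EuclideanSpace ℝ (Fin n) × EuclideanSpace ℝ (Fin m)) :
    HasLineDerivAt ℝ (grushinT γ) (2 * inner ℝ w.1 v.1 * (1 + γ) * grushinX w ^ γ +
      (1 + γ) ^ 2 * (2 * inner ℝ w.2 v.2)) w v := by
  have h : HasDerivAt (fun t : ℝ => w.2 + t • v.2) v.2 0 := by
    simpa using ((hasDerivAt_id (0 : ℝ)).smul_const v.2).const_add w.2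
  have := HasDerivAt.add (hasLineDerivAt_grushinX_rpow (1 + γ) w v)
    (h.norm_sq.const_mul ((1 + γ) ^ 2))
  exact this.congr_deriv (by simp)

theorem hasLineDerivAt_grushinT_rpow (hγ0 : 0 ≤ γ) (a : ℝ)
    (w v : EuclideanSpace ℝ (Fin n) × EuclideanSpace ℝ (Fin m)) :
    HasLineDerivAt ℝ (fun w => grushinT γ w ^ a)
      ((2 * inner ℝ w.1 v.1 * (1 + γ) * grushinX w ^ γ +
        (1 + γ) ^ 2 * (2 * inner ℝ w.2 v.2)) * a * grushinT γ w ^ (a - 1)) w v := by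
  have := HasDerivAt.rpow_const (p := a) (hasLineDerivAt_grushinT (γ := γ) w v)
    (.inl (grushinT_pos hγ0 _).ne')
  exact this.congr_deriv (by simp)

theorem grushinT_rpow_mul_grushinX_rpow_le_one (hq1 : q ≤ 1)
    (hpq : q * (1 + γ) ≤ 1) (w : EuclideanSpace ℝ (Fin n) × EuclideanSpace ℝ (Fin m)) :
    grushinT γ w ^ (q - 1) * grushinX w ^ γ ≤ 1 := by
  have hX := grushinX_pos w
  calc _ ≤ (grushinX w ^ (1 + γ)) ^ (q - 1) * grushinX w ^ γ := by
        refine mul_le_mul_of_nonneg_right ?_ (by positivity)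
        exact Real.rpow_le_rpow_of_nonpos (by positivity) (rpow_grushinX_le_grushinT w)
          (by linarith)
    _ = grushinX w ^ (q * (1 + γ) - 1) := by
        rw [← Real.rpow_mul hX.le, ← Real.rpow_add hX]; ring_nf
    _ ≤ 1 := Real.rpow_le_one_of_one_le_of_nonpos (one_le_grushinX w) (by linarith)

variable {f : EuclideanSpace ℝ (Fin n) × EuclideanSpace ℝ (Fin m) → ℝ}

theorem grushin_vertical_bound (hγ0 : 0 ≤ γ) (hγ1 : γ < 1) (hq0 : 0 < q) (hq1 : q < 1)
    (hpq : q * (1 + γ) ≤ 1) (hf : ContDiff ℝ 1 f) (hfs : HasCompactSupport f) (j : Fin m) :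
    ∫ w, f w ^ 2 * (‖w.1‖ ^ (2 * γ) * (q * (1 + γ) ^ 2 * grushinT γ w ^ (q - 1) * w.2 j) ^ 2) *
        Real.exp (-grushinT γ w ^ q) ≤
      (∫ w, ‖w.1‖ ^ (2 * γ) * dY n m f w j ^ 2 * Real.exp (-grushinT γ w ^ q)) +
        4 * ∫ w, f w ^ 2 * Real.exp (-grushinT γ w ^ q) := by
  have cT := continuous_grushinT_rpow (n := n) (m := m) hγ0
  have c1 := cT (q - 1)
  have c2 := cT (q - 1 - 1)
  have cρ : Continuous fun w : EuclideanSpace ℝ (Fin n) × EuclideanSpace ℝ (Fin m) =>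
      ‖w.1‖ ^ (2 * γ) := continuous_fst.norm.rpow_const fun _ => .inr (by linarith)
  refine integral_weight_mul_sq_le (U := fun w => grushinT γ w ^ q)
    (ψ := fun w => q * (1 + γ) ^ 2 * grushinT γ w ^ (q - 1) * w.2 j)
    (U' := fun w => 2 * (q * (1 + γ) ^ 2 * grushinT γ w ^ (q - 1) * w.2 j))
    (ψ' := fun w => q * (1 + γ) ^ 2 * ((1 + γ) ^ 2 * (2 * w.2 j) * (q - 1) *
      grushinT γ w ^ (q - 1 - 1)) * w.2 j + q * (1 + γ) ^ 2 * grushinT γ w ^ (q - 1))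
    (v := (0, EuclideanSpace.single j 1))
    (P := fun w => ‖w.1‖ ^ (2 * γ) * (q * (1 + γ) ^ 2 * grushinT γ w ^ (q - 1) * w.2 j) ^ 2)
    (ρ := fun w => ‖w.1‖ ^ (2 * γ))
    hf hfs (cT q) (by fun_prop) (by fun_prop) (by fun_prop) cρ (by fun_prop)
    (fun w => by positivity) (fun w t => by simp) (fun w => ?_) (fun w => ?_) (fun w => ?_)
  · exact HasDerivAt.congr_deriv
      (hasLineDerivAt_grushinT_rpow hγ0 q w (0, EuclideanSpace.single j 1))
      (by simp [EuclideanSpace.inner_single_right]; ring)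
  · have h1 := hasLineDerivAt_grushinT_rpow hγ0 (q - 1) w (0, EuclideanSpace.single j 1)
    have h2 : HasDerivAt (fun t : ℝ => (w + t • ((0 : EuclideanSpace ℝ (Fin n)),
        EuclideanSpace.single j (1 : ℝ))).2 j) 1 0 := by
      simpa using (hasDerivAt_id (0 : ℝ)).const_add (w.2 j)
    have h3 := (HasDerivAt.const_mul (q * (1 + γ) ^ 2) h1).mul h2
    exact h3.congr_deriv (by
      simp only [zero_smul, add_zero]
      simp [EuclideanSpace.inner_single_right])
  · have hT := grushinT_pos hγ0 w
    have hX := grushinX_pos w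
    have hx : ‖w.1‖ ^ (2 * γ) ≤ grushinX w ^ γ := by
      rw [Real.rpow_mul (norm_nonneg _)]
      refine Real.rpow_le_rpow (by positivity) ?_ hγ0
      simp [grushinX]
    have h1 := grushinT_rpow_mul_grushinX_rpow_le_one hq1.le hpq w
    have h2 : ‖w.1‖ ^ (2 * γ) * grushinT γ w ^ (q - 1) ≤ 1 := by
      refine le_trans ?_ h1
      rw [mul_comm]
      gcongr
    have hc : q * (1 + γ) ^ 2 ≤ 4 := by nlinarith
    have hc0 : 0 ≤ q * (1 + γ) ^ 2 := by positivity
    have h3 : 0 ≤ ‖w.1‖ ^ (2 * γ) * (q * (1 + γ) ^ 2 * ((1 + γ) ^ 2 * 2 * (1 - q) *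
      grushinT γ w ^ (q - 1 - 1)) * w.2 j ^ 2) := by
      have : 0 ≤ 1 - q := by linarith
      positivity
    have h4 : q * (1 + γ) ^ 2 * (‖w.1‖ ^ (2 * γ) * grushinT γ w ^ (q - 1)) ≤ 4 := by
      nlinarith
    linarith

theorem grushin_horizontal_bound (hγ0 : 0 ≤ γ) (hγ1 : γ < 1) (hq0 : 0 < q) (hq1 : q < 1)
    (hpq : q * (1 + γ) ≤ 1) (hf : ContDiff ℝ 1 f) (hfs : HasCompactSupport f) (i : Fin n) :
    ∫ w, f w ^ 2 * (q * (1 + γ) * grushinT γ w ^ (q - 1) * grushinX w ^ γ * w.1 i) ^ 2 *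
        Real.exp (-grushinT γ w ^ q) ≤
      (∫ w, dX n m f w i ^ 2 * Real.exp (-grushinT γ w ^ q)) +
        3 * ∫ w, f w ^ 2 * Real.exp (-grushinT γ w ^ q) := by
  have cT := continuous_grushinT_rpow (n := n) (m := m) hγ0
  have c1 := cT (q - 1)
  have c2 := cT (q - 1 - 1)
  have c3 := continuous_grushinX_rpow (n := n) (m := m) γ
  have c4 := continuous_grushinX_rpow (n := n) (m := m) (γ - 1)
  have key := integral_weight_mul_sq_le (U := fun w => grushinT γ w ^ q) (ρ := fun _ => 1)
    (C := 3) (μ := volume) (E := EuclideanSpace ℝ (Fin n) × EuclideanSpace ℝ (Fin m))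
    (P := fun w => (q * (1 + γ) * grushinT γ w ^ (q - 1) * grushinX w ^ γ * w.1 i) ^ 2)
    (ψ := fun w => q * (1 + γ) * grushinT γ w ^ (q - 1) * grushinX w ^ γ * w.1 i)
    (U' := fun w => 2 * (q * (1 + γ) * grushinT γ w ^ (q - 1) * grushinX w ^ γ * w.1 i))
    (ψ' := fun w => (q * (1 + γ) * (2 * w.1 i * (1 + γ) * grushinX w ^ γ * (q - 1) *
      grushinT γ w ^ (q - 1 - 1)) * grushinX w ^ γ + q * (1 + γ) * grushinT γ w ^ (q - 1) *
        (2 * w.1 i * γ * grushinX w ^ (γ - 1))) * w.1 i +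
        q * (1 + γ) * grushinT γ w ^ (q - 1) * grushinX w ^ γ)
    (v := (EuclideanSpace.single i 1, 0))
    hf hfs (cT q) (by fun_prop) (by fun_prop) (by fun_prop) (by fun_prop) (by fun_prop)
    (fun w => by positivity) (fun w t => by simp) (fun w => ?_) (fun w => ?_) (fun w => ?_)
  · simpa [dX] using key
  · exact HasDerivAt.congr_deriv
      (hasLineDerivAt_grushinT_rpow hγ0 q w (EuclideanSpace.single i 1, 0))
      (by simp [EuclideanSpace.inner_single_right]; ring)
  · have h1 := hasLineDerivAt_grushinT_rpow hγ0 (q - 1) w (EuclideanSpace.single i 1, 0)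
    have h1' := hasLineDerivAt_grushinX_rpow γ w (EuclideanSpace.single i 1, 0)
    have h2 : HasDerivAt (fun t : ℝ => (w + t • (EuclideanSpace.single i (1 : ℝ),
        (0 : EuclideanSpace ℝ (Fin m)))).1 i) 1 0 := by
      simpa using (hasDerivAt_id (0 : ℝ)).const_add (w.1 i)
    have h3 := ((HasDerivAt.const_mul (q * (1 + γ)) h1).mul h1').mul h2
    exact h3.congr_deriv (by
      simp only [Pi.mul_apply, zero_smul, add_zero]
      simp [EuclideanSpace.inner_single_right])
  · have hT := grushinT_pos hγ0 w
    have hX := grushinX_pos w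
    have h1 := grushinT_rpow_mul_grushinX_rpow_le_one hq1.le hpq w
    have h0 : 0 ≤ grushinT γ w ^ (q - 1) * grushinX w ^ γ := by positivity
    have hxi : w.1 i ^ 2 ≤ grushinX w := by
      have h := PiLp.norm_apply_le w.1 i
      have := sq_le_sq' (by linarith [norm_nonneg (w.1 i), norm_nonneg w.1]) h
      rw [Real.norm_eq_abs, sq_abs] at this
      unfold grushinX; linarith
    have hc0 : 0 ≤ q * (1 + γ) := by positivity
    have h3 : 0 ≤ q * (1 + γ) * (2 * (1 + γ) * grushinX w ^ γ * (1 - q) *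
      grushinT γ w ^ (q - 1 - 1)) * grushinX w ^ γ * w.1 i ^ 2 := by
      have : 0 ≤ 1 - q := by linarith
      positivity
    have h4 : q * (1 + γ) * grushinT γ w ^ (q - 1) * (2 * γ * grushinX w ^ (γ - 1)) * w.1 i ^ 2
        ≤ 2 := by
      calc _ ≤ q * (1 + γ) * grushinT γ w ^ (q - 1) * (2 * γ * grushinX w ^ (γ - 1)) *
            grushinX w := by gcongr
        _ = (q * (1 + γ)) * (2 * γ) * (grushinT γ w ^ (q - 1) * grushinX w ^ γ) := by
          rw [show γ = γ - 1 + 1 by ring, Real.rpow_add_one hX.ne']; ring_nf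
        _ ≤ 1 * 2 * 1 := by gcongr; linarith
        _ = 2 := by norm_num
    have h5 : q * (1 + γ) * (grushinT γ w ^ (q - 1) * grushinX w ^ γ) ≤ 1 :=
      mul_le_one₀ hpq h0 h1
    linarith

theorem grushin_axis_bound {τ : ℝ} (hγ0 : 0 ≤ γ) (hq0 : 0 < q) (hq1 : q < 1)
    (hpq : q * (1 + γ) ≤ 1) (hf : ContDiff ℝ 1 f) (hfs : HasCompactSupport f) (i : Fin n) :
    ∫ w, f w ^ 2 * ((1 + ‖w.2‖ ^ 2) ^ τ * (1 - 2 * ((1 + ‖w.2‖ ^ 2) ^ τ * w.1 i ^ 2)) /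
        (1 + (1 + ‖w.2‖ ^ 2) ^ τ * w.1 i ^ 2) ^ 2) * Real.exp (-grushinT γ w ^ q) ≤
      (∫ w, dX n m f w i ^ 2 * Real.exp (-grushinT γ w ^ q)) +
        2 * ∫ w, f w ^ 2 * Real.exp (-grushinT γ w ^ q) := by
  have cT := continuous_grushinT_rpow (n := n) (m := m) hγ0
  have c1 := cT (q - 1)
  have c3 := continuous_grushinX_rpow (n := n) (m := m) γ
  have cb : Continuous fun w : EuclideanSpace ℝ (Fin n) × EuclideanSpace ℝ (Fin m) =>
      (1 + ‖w.2‖ ^ 2) ^ τ :=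
    Continuous.rpow_const (by fun_prop) fun w => .inl (by positivity)
  have hne : ∀ w : EuclideanSpace ℝ (Fin n) × EuclideanSpace ℝ (Fin m),
    1 + (1 + ‖w.2‖ ^ 2) ^ τ * w.1 i ^ 2 ≠ 0 := fun w => by positivity
  have key := integral_weight_mul_sq_le (U := fun w => grushinT γ w ^ q) (ρ := fun _ => 1)
    (C := 2) (μ := volume) (E := EuclideanSpace ℝ (Fin n) × EuclideanSpace ℝ (Fin m))
    (P := fun w => (1 + ‖w.2‖ ^ 2) ^ τ * (1 - 2 * ((1 + ‖w.2‖ ^ 2) ^ τ * w.1 i ^ 2)) /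
        (1 + (1 + ‖w.2‖ ^ 2) ^ τ * w.1 i ^ 2) ^ 2)
    (ψ := fun w => -((1 + ‖w.2‖ ^ 2) ^ τ * w.1 i) / (1 + (1 + ‖w.2‖ ^ 2) ^ τ * w.1 i ^ 2))
    (U' := fun w => 2 * (q * (1 + γ) * grushinT γ w ^ (q - 1) * grushinX w ^ γ * w.1 i))
    (ψ' := fun w => -((1 + ‖w.2‖ ^ 2) ^ τ * (1 - (1 + ‖w.2‖ ^ 2) ^ τ * w.1 i ^ 2)) /
      (1 + (1 + ‖w.2‖ ^ 2) ^ τ * w.1 i ^ 2) ^ 2)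
    (v := (EuclideanSpace.single i 1, 0))
    hf hfs (cT q) (by fun_prop) (Continuous.div (by fun_prop) (by fun_prop) hne)
    (Continuous.div (by fun_prop) (by fun_prop) fun w => pow_ne_zero 2 (hne w))
    (by fun_prop) (Continuous.div (by fun_prop) (by fun_prop) fun w => pow_ne_zero 2 (hne w))
    (fun w => by positivity) (fun w t => by simp) (fun w => ?_) (fun w => ?_) (fun w => ?_)
  · simpa [dX] using key
  · exact HasDerivAt.congr_deriv
      (hasLineDerivAt_grushinT_rpow hγ0 q w (EuclideanSpace.single i 1, 0))
      (by simp [EuclideanSpace.inner_single_right]; ring)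
  · have h2 : HasDerivAt (fun t : ℝ => w.1 i + t) 1 0 := by
      simpa using (hasDerivAt_id (0 : ℝ)).const_add (w.1 i)
    have h3 := (h2.const_mul ((1 + ‖w.2‖ ^ 2) ^ τ)).neg.div
      (((h2.pow 2).const_mul ((1 + ‖w.2‖ ^ 2) ^ τ)).const_add 1) (by simpa using hne w)
    unfold HasLineDerivAt
    have h4 : HasDerivAt _ (-((1 + ‖w.2‖ ^ 2) ^ τ *
      (1 - (1 + ‖w.2‖ ^ 2) ^ τ * w.1 i ^ 2)) / (1 + (1 + ‖w.2‖ ^ 2) ^ τ * w.1 i ^ 2) ^ 2) (0 : ℝ) :=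
      h3.congr_deriv (by simp; ring)
    refine h4.congr_of_eventuallyEq (.of_forall fun t => ?_)
    simp
  · have hT := grushinT_pos hγ0 w
    have hX := grushinX_pos w
    have h1 := grushinT_rpow_mul_grushinX_rpow_le_one hq1.le hpq w
    have h0 : 0 ≤ grushinT γ w ^ (q - 1) * grushinX w ^ γ := by positivity
    have h5 : q * (1 + γ) * (grushinT γ w ^ (q - 1) * grushinX w ^ γ) ≤ 1 :=
      mul_le_one₀ hpq h0 h1
    have h50 : 0 ≤ q * (1 + γ) * (grushinT γ w ^ (q - 1) * grushinX w ^ γ) := by positivity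
    simp only
    have hu0 : 0 ≤ (1 + ‖w.2‖ ^ 2) ^ τ * w.1 i ^ 2 := by positivity
    have hb0 : 0 ≤ (1 + ‖w.2‖ ^ 2) ^ τ := by positivity
    generalize (1 + ‖w.2‖ ^ 2) ^ τ = b at *
    have e : 1 * (-(b * w.1 i) / (1 + b * w.1 i ^ 2) *
        (2 * (q * (1 + γ) * grushinT γ w ^ (q - 1) * grushinX w ^ γ * w.1 i)) -
        -(b * (1 - b * w.1 i ^ 2)) / (1 + b * w.1 i ^ 2) ^ 2 -
        (-(b * w.1 i) / (1 + b * w.1 i ^ 2)) ^ 2) + 2 -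
        b * (1 - 2 * (b * w.1 i ^ 2)) / (1 + b * w.1 i ^ 2) ^ 2 =
        2 - 2 * (q * (1 + γ) * (grushinT γ w ^ (q - 1) * grushinX w ^ γ)) *
          (b * w.1 i ^ 2 / (1 + b * w.1 i ^ 2)) := by
      have : 1 + b * w.1 i ^ 2 ≠ 0 := by positivity
      field_simp
      ring
    have h6 : b * w.1 i ^ 2 / (1 + b * w.1 i ^ 2) ≤ 1 := by
      rw [div_le_one (by positivity)]; linarith
    have h7 : 0 ≤ b * w.1 i ^ 2 / (1 + b * w.1 i ^ 2) := by positivity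
    nlinarith [mul_le_one₀ h5 h7 h6]

end Gauge

section Energy

variable {n m : ℕ} {γ q : ℝ} {f : EuclideanSpace ℝ (Fin n) × EuclideanSpace ℝ (Fin m) → ℝ}

theorem continuous_dX (hf : ContDiff ℝ 1 f) (i : Fin n) :
    Continuous fun w => dX n m f w i :=
  (hf.continuous_fderiv one_ne_zero).clm_apply continuous_const

theorem continuous_dY (hf : ContDiff ℝ 1 f) (j : Fin m) :
    Continuous fun w => dY n m f w j :=
  (hf.continuous_fderiv one_ne_zero).clm_apply continuous_const

theorem continuous_norm_fst_rpow (hγ0 : 0 ≤ γ) : Continuous fun w :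
    EuclideanSpace ℝ (Fin n) × EuclideanSpace ℝ (Fin m) => ‖w.1‖ ^ (2 * γ) :=
  continuous_fst.norm.rpow_const fun _ => .inr (by linarith)

theorem continuous_gradSqG (hγ0 : 0 ≤ γ) (hf : ContDiff ℝ 1 f) :
    Continuous (gradSqG n m γ f) := by
  have h1 := fun i => continuous_dX hf i
  have h2 := fun j => continuous_dY hf j
  have h3 := continuous_norm_fst_rpow (n := n) (m := m) hγ0
  unfold gradSqG
  fun_prop

theorem hasCompactSupport_gradSqG (hfs : HasCompactSupport f) :
    HasCompactSupport (gradSqG n m γ f) := by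
  refine (hfs.fderiv ℝ).mono fun w hw => ?_
  contrapose! hw
  simp only [Function.mem_support, not_not] at hw ⊢
  simp [gradSqG, dX, dY, hw]

theorem gradSqG_nonneg (w : EuclideanSpace ℝ (Fin n) × EuclideanSpace ℝ (Fin m)) :
    0 ≤ gradSqG n m γ f w := by
  unfold gradSqG; positivity

theorem continuous_exp_neg_grushinT (hγ0 : 0 ≤ γ) : Continuous fun w :
    EuclideanSpace ℝ (Fin n) × EuclideanSpace ℝ (Fin m) => Real.exp (-grushinT γ w ^ q) :=
  Real.continuous_exp.comp (continuous_grushinT_rpow hγ0 q).neg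

theorem integral_gradSqG (hγ0 : 0 ≤ γ) (hf : ContDiff ℝ 1 f) (hfs : HasCompactSupport f) :
    ∫ w, gradSqG n m γ f w * Real.exp (-grushinT γ w ^ q) =
      ∑ i, (∫ w, dX n m f w i ^ 2 * Real.exp (-grushinT γ w ^ q)) +
      ∑ j, (∫ w, ‖w.1‖ ^ (2 * γ) * dY n m f w j ^ 2 * Real.exp (-grushinT γ w ^ q)) := by
  have cW := continuous_exp_neg_grushinT (n := n) (m := m) (q := q) hγ0
  have cρ := continuous_norm_fst_rpow (n := n) (m := m) hγ0
  have i1 : ∀ i, Integrable fun w => dX n m f w i ^ 2 * Real.exp (-grushinT γ w ^ q) := fun i =>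
    (((continuous_dX hf i).pow 2).mul cW).integrable_of_hasCompactSupport
      ((hfs.fderiv ℝ).mono fun w hw h => hw (by simp [dX, h]))
  have i2 : ∀ j, Integrable fun w => ‖w.1‖ ^ (2 * γ) * dY n m f w j ^ 2 *
      Real.exp (-grushinT γ w ^ q) := fun j =>
    ((cρ.mul ((continuous_dY hf j).pow 2)).mul cW).integrable_of_hasCompactSupport
      ((hfs.fderiv ℝ).mono fun w hw h => hw (by simp [dY, h]))
  rw [← integral_finsetSum _ fun i _ => i1 i, ← integral_finsetSum _ fun j _ => i2 j,
    ← integral_add (integrable_finsetSum _ fun i _ => i1 i)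
      (integrable_finsetSum _ fun j _ => i2 j)]
  congr 1 with w
  simp only [gradSqG, add_mul, Finset.sum_mul, Finset.mul_sum]

/-- The potential produced by the axis bound. -/
noncomputable def grushinAxisPotential (τ : ℝ) (i : Fin n)
    (w : EuclideanSpace ℝ (Fin n) × EuclideanSpace ℝ (Fin m)) : ℝ :=
  (1 + ‖w.2‖ ^ 2) ^ τ * (1 - 2 * ((1 + ‖w.2‖ ^ 2) ^ τ * w.1 i ^ 2)) /
    (1 + (1 + ‖w.2‖ ^ 2) ^ τ * w.1 i ^ 2) ^ 2

theorem continuous_grushinAxisPotential (τ : ℝ) (i : Fin n) :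
    Continuous (grushinAxisPotential (m := m) τ i) := by
  have cb : Continuous fun w : EuclideanSpace ℝ (Fin n) × EuclideanSpace ℝ (Fin m) =>
      (1 + ‖w.2‖ ^ 2) ^ τ :=
    Continuous.rpow_const (by fun_prop) fun w => .inl (by positivity)
  exact Continuous.div (by fun_prop) (by fun_prop) fun w => by positivity

theorem grushinT_rpow_le_sum (hγ0 : 0 ≤ γ) (hγ1 : γ < 1) (hq0 : 1 / 2 < q)
    (hq1 : q < 1) (hpq : q * (1 + γ) ≤ 1) {τ : ℝ} (hτ : τ * (1 + γ) = 2 * q - 1) (i₀ : Fin n)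
    (w : EuclideanSpace ℝ (Fin n) × EuclideanSpace ℝ (Fin m)) :
    grushinT γ w ^ τ ≤ 16 * grushinAxisPotential τ i₀ w +
      1680 * (∑ i, (q * (1 + γ) * grushinT γ w ^ (q - 1) * grushinX w ^ γ * w.1 i) ^ 2) +
      1680 * (∑ j, ‖w.1‖ ^ (2 * γ) * (q * (1 + γ) ^ 2 * grushinT γ w ^ (q - 1) * w.2 j) ^ 2) +
      21 := by
  have hTpos := grushinT_pos hγ0 w
  have hXpos := grushinX_pos w
  have hT2 : (grushinT γ w ^ (q - 1)) ^ 2 = grushinT γ w ^ (2 * q - 2) := by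
    rw [← Real.rpow_natCast, ← Real.rpow_mul hTpos.le]; congr 1; push_cast; ring
  have hX2 : (grushinX w ^ γ) ^ 2 = grushinX w ^ (2 * γ) := by
    rw [← Real.rpow_natCast, ← Real.rpow_mul hXpos.le]; congr 1; push_cast; ring
  have hx1 : ∑ i, w.1 i ^ 2 = grushinX w - 1 := by
    simp [grushinX, EuclideanSpace.norm_sq_eq]
  have hy1 : ∑ j, w.2 j ^ 2 = ‖w.2‖ ^ 2 := by simp [EuclideanSpace.norm_sq_eq]
  have hρ : ‖w.1‖ ^ (2 * γ) = (grushinX w - 1) ^ γ := by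
    rw [Real.rpow_mul (norm_nonneg _)]; simp [grushinX]
  have hs : w.1 i₀ ^ 2 ≤ grushinX w - 1 := by
    rw [← hx1]
    exact Finset.single_le_sum (f := fun i => w.1 i ^ 2) (fun i _ => sq_nonneg _)
      (Finset.mem_univ i₀)
  have hco := grushin_coercivity hγ0 hγ1 hq0 hq1 hpq hτ (one_le_grushinX w)
    (sq_nonneg ‖w.2‖) hs rfl (by positivity)
  have e1 : ∑ i, (q * (1 + γ) * grushinT γ w ^ (q - 1) * grushinX w ^ γ * w.1 i) ^ 2 =
      (q * (1 + γ)) ^ 2 * grushinT γ w ^ (2 * q - 2) * grushinX w ^ (2 * γ) *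
        (grushinX w - 1) := by
    rw [← hx1, ← hT2, ← hX2, Finset.mul_sum]
    exact Finset.sum_congr rfl fun i _ => by ring
  have e2 : ∑ j, ‖w.1‖ ^ (2 * γ) * (q * (1 + γ) ^ 2 * grushinT γ w ^ (q - 1) * w.2 j) ^ 2 =
      (grushinX w - 1) ^ γ *
        ((q * (1 + γ) ^ 2) ^ 2 * grushinT γ w ^ (2 * q - 2) * ‖w.2‖ ^ 2) := by
    rw [← hy1, ← hT2, ← hρ]
    simp only [Finset.mul_sum]
    exact Finset.sum_congr rfl fun i _ => by ring
  rw [e1, e2]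
  refine hco.trans_eq ?_
  unfold grushinT grushinAxisPotential
  ring

theorem integral_le_sum_of_le {α ι κ : Type*} [Fintype ι] [Fintype κ] [MeasurableSpace α]
    {μ : Measure α} {g J h : α → ℝ} {A : ι → α → ℝ} {B : κ → α → ℝ} {a b c : ℝ}
    (hg : Integrable g μ) (hJ : Integrable J μ) (hh : Integrable h μ)
    (hA : ∀ i, Integrable (A i) μ) (hB : ∀ j, Integrable (B j) μ)
    (hle : ∀ w, g w ≤ a * J w + b * (∑ i, A i w) + b * (∑ j, B j w) + c * h w) :
    ∫ w, g w ∂μ ≤ a * (∫ w, J w ∂μ) + b * (∑ i, ∫ w, A i w ∂μ) + b * (∑ j, ∫ w, B j w ∂μ) +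
      c * ∫ w, h w ∂μ := by
  have hA' := (integrable_finsetSum Finset.univ fun i _ => hA i).const_mul b
  have hB' := (integrable_finsetSum Finset.univ fun j _ => hB j).const_mul b
  have hJ' := hJ.const_mul a
  have hh' := hh.const_mul c
  refine (integral_mono hg (((hJ'.add hA').add hB').add hh') hle).trans_eq ?_
  rw [integral_add' ((hJ'.add hA').add hB') hh', integral_add' (hJ'.add hA') hB',
    integral_add' hJ' hA', integral_const_mul, integral_const_mul, integral_const_mul,
    integral_const_mul, integral_finsetSum _ fun i _ => hA i,
    integral_finsetSum _ fun i _ => hB i]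

theorem grushin_moment_bound (hn : 1 ≤ n) (hγ0 : 0 ≤ γ) (hγ1 : γ < 1) (hq0 : 1 / 2 < q)
    (hq1 : q < 1) (hpq : q * (1 + γ) ≤ 1) {τ : ℝ} (hτ : τ * (1 + γ) = 2 * q - 1)
    (hf : ContDiff ℝ 1 f) (hfs : HasCompactSupport f) :
    ∫ w, f w ^ 2 * grushinT γ w ^ τ * Real.exp (-grushinT γ w ^ q) ≤
      1696 * (∫ w, gradSqG n m γ f w * Real.exp (-grushinT γ w ^ q)) +
      (53 + 1680 * (3 * n + 4 * m)) * ∫ w, f w ^ 2 * Real.exp (-grushinT γ w ^ q) := by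
  have hqp : 0 < q := by linarith
  have cW := continuous_exp_neg_grushinT (n := n) (m := m) (q := q) hγ0
  have cρ := continuous_norm_fst_rpow (n := n) (m := m) hγ0
  have cT := continuous_grushinT_rpow (n := n) (m := m) hγ0
  have c1 := cT (q - 1)
  have c3 := continuous_grushinX_rpow (n := n) (m := m) γ
  have hfc := hf.continuous
  have key : ∀ g : EuclideanSpace ℝ (Fin n) × EuclideanSpace ℝ (Fin m) → ℝ, Continuous g →
      Integrable fun w => f w ^ 2 * g w * Real.exp (-grushinT γ w ^ q) := fun g hg =>
    (((hfc.pow 2).mul hg).mul cW).integrable_of_hasCompactSupport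
      (hfs.mono fun w hw h => hw (by simp [h]))
  set i₀ : Fin n := ⟨0, hn⟩
  have hJ : ∫ w, f w ^ 2 * grushinAxisPotential τ i₀ w * Real.exp (-grushinT γ w ^ q) ≤ _ :=
    grushin_axis_bound (τ := τ) hγ0 hqp hq1 hpq hf hfs i₀
  have hsX := Finset.sum_le_sum fun i (_ : i ∈ Finset.univ) =>
    grushin_horizontal_bound hγ0 hγ1 hqp hq1 hpq hf hfs i
  have hsY := Finset.sum_le_sum fun j (_ : j ∈ Finset.univ) =>
    grushin_vertical_bound hγ0 hγ1 hqp hq1 hpq hf hfs j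
  rw [Finset.sum_add_distrib] at hsX hsY
  simp only [Finset.sum_const, Finset.card_univ, Fintype.card_fin, nsmul_eq_mul] at hsX hsY
  have hE := integral_gradSqG (q := q) hγ0 hf hfs
  have hE0 : 0 ≤ ∑ j, (∫ w, ‖w.1‖ ^ (2 * γ) * dY n m f w j ^ 2 *
      Real.exp (-grushinT γ w ^ q)) :=
    Finset.sum_nonneg fun j _ => integral_nonneg fun w => by positivity
  have hE1 : ∫ w, dX n m f w i₀ ^ 2 * Real.exp (-grushinT γ w ^ q) ≤
      ∑ i, ∫ w, dX n m f w i ^ 2 * Real.exp (-grushinT γ w ^ q) :=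
    Finset.single_le_sum (f := fun i => ∫ w, dX n m f w i ^ 2 * Real.exp (-grushinT γ w ^ q))
      (fun i _ => integral_nonneg fun w => by positivity) (Finset.mem_univ i₀)
  have k1 := key (fun _ => 1) continuous_const
  simp only [mul_one] at k1
  have hsum := integral_le_sum_of_le (key _ (cT τ))
    (key _ (continuous_grushinAxisPotential τ i₀)) k1
    (fun i => key (fun w => (q * (1 + γ) * grushinT γ w ^ (q - 1) * grushinX w ^ γ * w.1 i) ^ 2)
      (by fun_prop))
    (fun j => key (fun w => ‖w.1‖ ^ (2 * γ) *
      (q * (1 + γ) ^ 2 * grushinT γ w ^ (q - 1) * w.2 j) ^ 2) (by fun_prop))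
    (a := 16) (b := 1680) (c := 21) fun w => by
      have := mul_le_mul_of_nonneg_right (mul_le_mul_of_nonneg_left
        (grushinT_rpow_le_sum hγ0 hγ1 hq0 hq1 hpq hτ i₀ w) (sq_nonneg (f w)))
        (Real.exp_pos (-grushinT γ w ^ q)).le
      refine this.trans_eq ?_
      simp only [Finset.mul_sum, Finset.sum_mul, mul_add, add_mul]
      congr 1
      · congr 1
        · congr 1
          · ring
          · exact Finset.sum_congr rfl fun i _ => by ring
        · exact Finset.sum_congr rfl fun i _ => by ring
      · ring
  rw [hE]
  linarith

end Energy

section Local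

variable {n m : ℕ} {γ q : ℝ} {f : EuclideanSpace ℝ (Fin n) × EuclideanSpace ℝ (Fin m) → ℝ}

theorem grushinT_add_le (hγ0 : 0 ≤ γ) (hγ1 : γ < 1)
    (z h : EuclideanSpace ℝ (Fin n) × EuclideanSpace ℝ (Fin m))
    (hk : ‖h.1‖ ≤ 3) (hl : ‖h.2‖ ≤ 1) : grushinT γ (z + h) ≤ 400 * grushinT γ z := by
  have hX := one_le_grushinX z
  have h1 : ‖z.1 + h.1‖ ^ 2 ≤ 2 * ‖z.1‖ ^ 2 + 18 := by
    have := norm_add_le z.1 h.1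
    nlinarith [norm_nonneg (z.1 + h.1), norm_nonneg z.1, norm_nonneg h.1,
      sq_nonneg (‖z.1‖ - ‖h.1‖)]
  have h2 : ‖z.2 + h.2‖ ^ 2 ≤ 2 * ‖z.2‖ ^ 2 + 2 := by
    have := norm_add_le z.2 h.2
    nlinarith [norm_nonneg (z.2 + h.2), norm_nonneg z.2, norm_nonneg h.2,
      sq_nonneg (‖z.2‖ - ‖h.2‖)]
  have h3 : grushinX (z + h) ≤ 19 * grushinX z := by
    unfold grushinX at *
    simp only [Prod.fst_add]
    nlinarith [sq_nonneg ‖z.1‖]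
  have h4 : grushinX (z + h) ^ (1 + γ) ≤ 361 * grushinX z ^ (1 + γ) := by
    calc _ ≤ (19 * grushinX z) ^ (1 + γ) :=
          Real.rpow_le_rpow (grushinX_pos _).le h3 (by linarith)
      _ = 19 ^ (1 + γ) * grushinX z ^ (1 + γ) := Real.mul_rpow (by norm_num) (by linarith)
      _ ≤ 19 ^ (2 : ℝ) * grushinX z ^ (1 + γ) := by
          gcongr
          · norm_num
          · linarith
      _ = _ := by norm_num
  have h5 : 1 ≤ grushinX z ^ (1 + γ) := Real.one_le_rpow hX (by linarith)
  have h6 : (1 + γ) ^ 2 ≤ 4 := by nlinarith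
  have h7 := mul_le_mul_of_nonneg_left h2 (sq_nonneg (1 + γ))
  have h8 : 0 ≤ (1 + γ) ^ 2 * ‖z.2‖ ^ 2 := by positivity
  unfold grushinT
  simp only [Prod.snd_add]
  linarith

theorem one_le_exp_mul_exp_neg_grushinT (hγ0 : 0 ≤ γ) (hγ1 : γ < 1) (hq0 : 0 < q) (hq1 : q < 1)
    {R : ℝ} (hR : 1 ≤ R) {z h : EuclideanSpace ℝ (Fin n) × EuclideanSpace ℝ (Fin m)}
    (hz : grushinT γ z ≤ R) (hk : ‖h.1‖ ≤ 3) (hl : ‖h.2‖ ≤ 1) :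
    1 ≤ Real.exp (400 * R ^ q) * Real.exp (-grushinT γ (z + h) ^ q) := by
  rw [← Real.exp_add, Real.one_le_exp_iff, ← sub_eq_add_neg, sub_nonneg]
  calc grushinT γ (z + h) ^ q ≤ (400 * R) ^ q :=
        Real.rpow_le_rpow (grushinT_pos hγ0 _).le
          ((grushinT_add_le hγ0 hγ1 z h hk hl).trans (by linarith)) hq0.le
    _ = 400 ^ q * R ^ q := Real.mul_rpow (by norm_num) (by linarith)
    _ ≤ 400 ^ (1 : ℝ) * R ^ q := by
        gcongr
        norm_num
    _ = _ := by norm_num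

theorem clm_apply_sq_le {ι : Type*} [Fintype ι] [DecidableEq ι] (L : EuclideanSpace ℝ ι →L[ℝ] ℝ)
    (k : EuclideanSpace ℝ ι) :
    L k ^ 2 ≤ ‖k‖ ^ 2 * ∑ i, L (EuclideanSpace.single i 1) ^ 2 := by
  have h : L k = ∑ i, k i * L (EuclideanSpace.single i 1) := by
    conv_lhs => rw [← (EuclideanSpace.basisFun ι ℝ).sum_repr k]
    simp
  rw [h, EuclideanSpace.norm_sq_eq]
  simpa using Finset.sum_mul_sq_le_sq_mul_sq Finset.univ (fun i => k i)
    fun i => L (EuclideanSpace.single i 1)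

theorem fderiv_horizontal_sq_le (w : EuclideanSpace ℝ (Fin n) × EuclideanSpace ℝ (Fin m))
    (k : EuclideanSpace ℝ (Fin n)) :
    fderiv ℝ f w (k, 0) ^ 2 ≤ ‖k‖ ^ 2 * ∑ i, dX n m f w i ^ 2 :=
  clm_apply_sq_le ((fderiv ℝ f w).comp (ContinuousLinearMap.inl ℝ _ _)) k

theorem fderiv_vertical_sq_le (w : EuclideanSpace ℝ (Fin n) × EuclideanSpace ℝ (Fin m))
    (l : EuclideanSpace ℝ (Fin m)) :
    fderiv ℝ f w (0, l) ^ 2 ≤ ‖l‖ ^ 2 * ∑ j, dY n m f w j ^ 2 :=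
  clm_apply_sq_le ((fderiv ℝ f w).comp (ContinuousLinearMap.inr ℝ _ _)) l

theorem setIntegral_sq_sub_translate_le {K : Set (EuclideanSpace ℝ (Fin n) ×
      EuclideanSpace ℝ (Fin m))} (hK : MeasurableSet K)
    (hγ0 : 0 ≤ γ) (hf : ContDiff ℝ 1 f) (hfs : HasCompactSupport f) {A : ℝ} (hA : 0 ≤ A)
    {a k : EuclideanSpace ℝ (Fin n) × EuclideanSpace ℝ (Fin m)}
    (hle : ∀ z ∈ K, ∀ t ∈ Set.Icc (0 : ℝ) 1, fderiv ℝ f (z + a + t • k) k ^ 2 ≤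
      A * (gradSqG n m γ f (z + a + t • k) * Real.exp (-grushinT γ (z + a + t • k) ^ q))) :
    ∫ z in K, (f (z + a + k) - f (z + a)) ^ 2 ≤
      A * ∫ w, gradSqG n m γ f w * Real.exp (-grushinT γ w ^ q) := by
  have cW := continuous_exp_neg_grushinT (n := n) (m := m) (q := q) hγ0
  have cg := continuous_gradSqG hγ0 hf
  have hfc := hf.continuous
  have cF : Continuous fun w => A * (gradSqG n m γ f w * Real.exp (-grushinT γ w ^ q)) := by
    fun_prop
  have hc : Continuous fun w => fderiv ℝ f w k :=
    (hf.continuous_fderiv one_ne_zero).clm_apply continuous_const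
  rw [← integral_const_mul]
  refine setIntegral_le_of_le_integral_segment hK cF
    ((hasCompactSupport_gradSqG (γ := γ) hfs).mono fun w hw h => hw (by simp [h]))
    (fun w => mul_nonneg hA (mul_nonneg (gradSqG_nonneg w) (Real.exp_pos _).le))
    (by fun_prop) (fun w => sq_nonneg _) (a := a) (k := k) fun z hz => ?_
  refine (sq_sub_le_integral_fderiv_sq hf (z + a) k).trans ?_
  refine intervalIntegral.integral_mono_on zero_le_one ?_ ?_ (hle z hz)
  · exact ((hc.comp (by fun_prop : Continuous fun t : ℝ => z + a + t • k)).pow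
      2).intervalIntegrable _ _
  · exact (cF.comp (by fun_prop : Continuous fun t : ℝ => z + a + t • k)).intervalIntegrable _ _

theorem integrable_sq_sub_translate (hf : Continuous f) (hfs : HasCompactSupport f)
    (a b : EuclideanSpace ℝ (Fin n) × EuclideanSpace ℝ (Fin m)) :
    Integrable fun z => (f (z + a) - f (z + b)) ^ 2 := by
  have h := fun c => hfs.comp_homeomorph (Homeomorph.addRight c)
  exact Continuous.integrable_of_hasCompactSupport (by fun_prop)
    (((h a).sub (h b)).mono fun w hw h => hw (by
      simp only [Pi.sub_apply, Function.comp_apply, Homeomorph.coe_addRight] at h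
      simp [h]))

theorem volume_real_ball_prod_ball (x : EuclideanSpace ℝ (Fin n)) (y : EuclideanSpace ℝ (Fin m))
    {δ : ℝ} (hδ : 0 < δ) :
    (volume : Measure (EuclideanSpace ℝ (Fin n) × EuclideanSpace ℝ (Fin m))).real
      (Metric.ball x δ ×ˢ Metric.ball y (δ ^ 2)) = δ ^ (n + 2 * m) *
        (volume.real (Metric.ball (0 : EuclideanSpace ℝ (Fin n)) 1) *
          volume.real (Metric.ball (0 : EuclideanSpace ℝ (Fin m)) 1)) := by
  rw [Measure.volume_eq_prod, measureReal_prod_prod, Measure.real, Measure.real,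
    Measure.addHaar_ball_of_pos _ _ hδ, Measure.addHaar_ball_of_pos _ _ (pow_pos hδ 2)]
  simp only [finrank_euclideanSpace, Fintype.card_fin, ENNReal.toReal_mul, Measure.real]
  rw [ENNReal.toReal_ofReal (by positivity), ENNReal.toReal_ofReal (by positivity)]
  ring

theorem halfSpace_local_bound (hγ0 : 0 ≤ γ) (hγ1 : γ < 1) (hq0 : 0 < q) (hq1 : q < 1)
    (hf : ContDiff ℝ 1 f) (hfs : HasCompactSupport f) (i : Fin n) {R δ σ : ℝ} (hR : 1 ≤ R)
    (hδ0 : 0 < δ) (hδ1 : δ ≤ 1) (hσ : |σ| = 1) :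
    ∫ z in {z | grushinT γ z ≤ R ∧ 0 ≤ σ * z.1 i}, f z ^ 2 ≤
      20 * Real.exp (400 * R ^ q) * δ ^ 2 *
        (∫ w, gradSqG n m γ f w * Real.exp (-grushinT γ w ^ q)) +
      2 * Real.exp (400 * R ^ q) ^ 2 * ((δ ^ (n + 2 * m) *
        (volume.real (Metric.ball (0 : EuclideanSpace ℝ (Fin n)) 1) *
          volume.real (Metric.ball (0 : EuclideanSpace ℝ (Fin m)) 1)))⁻¹ *
        (∫ w, |f w| * Real.exp (-grushinT γ w ^ q)) ^ 2) := by
  have cW := continuous_exp_neg_grushinT (n := n) (m := m) (q := q) hγ0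
  have cT := continuous_grushinT (n := n) (m := m) (γ := γ)
  have hfc := hf.continuous
  have cσ : Continuous fun z : EuclideanSpace ℝ (Fin n) × EuclideanSpace ℝ (Fin m) =>
      σ * z.1 i := by fun_prop
  set K : Set (EuclideanSpace ℝ (Fin n) × EuclideanSpace ℝ (Fin m)) :=
    {z | grushinT γ z ≤ R ∧ 0 ≤ σ * z.1 i} with hKdef
  have hK : MeasurableSet K :=
    (measurableSet_le cT.measurable measurable_const).inter
      (measurableSet_le measurable_const cσ.measurable)
  set S := Metric.ball (EuclideanSpace.single i (2 * δ * σ)) δ ×ˢ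
    Metric.ball (0 : EuclideanSpace ℝ (Fin m)) (δ ^ 2) with hSdef
  have hS0 : volume S ≠ 0 := by
    refine (IsOpen.measure_pos _ (Metric.isOpen_ball.prod Metric.isOpen_ball) ?_).ne'
    exact ⟨(EuclideanSpace.single i (2 * δ * σ), 0), by simp [hδ0]⟩
  have hS1 : volume S ≠ ⊤ :=
    ((Metric.isBounded_ball.prod Metric.isBounded_ball).measure_lt_top).ne
  set M := Real.exp (400 * R ^ q) with hM
  have hM0 : 0 < M := Real.exp_pos _
  have ca : Continuous fun w => |f w| * Real.exp (-grushinT γ w ^ q) := by fun_prop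
  have sa : HasCompactSupport fun w => |f w| * Real.exp (-grushinT γ w ^ q) :=
    hfs.mono fun w hw h => hw (by simp [h])
  obtain ⟨h, hh, hint⟩ := exists_integral_mul_translate_le
    (ca.integrable_of_hasCompactSupport (μ := volume) sa)
    (fun w => by positivity) hS0 hS1
  rw [hSdef, volume_real_ball_prod_ball _ _ hδ0] at hint
  obtain ⟨k, l⟩ := h
  obtain ⟨hk, hl⟩ := hh
  simp only [Metric.mem_ball, dist_eq_norm, sub_zero] at hk hl
  have hki := (PiLp.norm_apply_le (k - EuclideanSpace.single i (2 * δ * σ)) i).trans_lt hk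
  have hk3 : ‖k‖ ≤ 3 * δ := by
    have := norm_le_norm_sub_add k (EuclideanSpace.single i (2 * δ * σ))
    have e : ‖EuclideanSpace.single i (2 * δ * σ)‖ = 2 * δ := by
      simp [hσ, abs_of_pos hδ0]
    linarith
  have hσ2 : σ * σ = 1 := by rw [← abs_mul_abs_self, hσ, one_mul]
  have hkσ : δ ≤ σ * k i := by
    have h1 : |σ * (k i - 2 * δ * σ)| < δ := by
      rw [abs_mul, hσ, one_mul]; simpa using hki
    have h2 := (abs_lt.1 h1).1
    have : σ * (k i - 2 * δ * σ) = σ * k i - 2 * δ * (σ * σ) := by ring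
    rw [this, hσ2] at h2
    linarith
  have hw : ∀ z ∈ K, ∀ h' : EuclideanSpace ℝ (Fin n) × EuclideanSpace ℝ (Fin m),
      ‖h'.1‖ ≤ 3 → ‖h'.2‖ ≤ 1 → 1 ≤ M * Real.exp (-grushinT γ (z + h') ^ q) :=
    fun z hz h' h1 h2 => one_le_exp_mul_exp_neg_grushinT hγ0 hγ1 hq0 hq1 hR hz.1 h1 h2
  have step1 := setIntegral_sq_sub_translate_le (q := q) hK hγ0 hf hfs
    (A := 9 * M * δ ^ 2) (by positivity) (a := 0) (k := (k, 0)) fun z hz t ht => by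
      have h1 := hw z hz (t • (k, 0)) (by
        simp only [Prod.smul_fst, norm_smul, Real.norm_eq_abs, abs_of_nonneg ht.1]
        nlinarith [ht.2, ht.1, norm_nonneg k]) (by simp)
      rw [add_zero]
      set w := z + t • (k, (0 : EuclideanSpace ℝ (Fin m)))
      calc fderiv ℝ f w (k, 0) ^ 2 ≤ ‖k‖ ^ 2 * ∑ i, dX n m f w i ^ 2 :=
            fderiv_horizontal_sq_le w k
        _ ≤ (3 * δ) ^ 2 * gradSqG n m γ f w := by
            gcongr
            exact le_add_of_nonneg_right (by positivity)
        _ ≤ (3 * δ) ^ 2 * gradSqG n m γ f w * (M * Real.exp (-grushinT γ w ^ q)) :=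
            le_mul_of_one_le_right (mul_nonneg (by positivity) (gradSqG_nonneg w)) h1
        _ = _ := by ring
  have step2 := setIntegral_sq_sub_translate_le (q := q) hK hγ0 hf hfs
    (A := M * δ ^ 2) (by positivity) (a := (k, 0)) (k := (0, l)) fun z hz t ht => by
      have hl1 : ‖l‖ ≤ 1 := hl.le.trans (pow_le_one₀ hδ0.le hδ1)
      have h1 := hw z hz ((k, 0) + t • (0, l)) (by simp; linarith) (by
        simp only [Prod.snd_add, Prod.smul_snd, zero_add, norm_smul, Real.norm_eq_abs,
          abs_of_nonneg ht.1]
        exact mul_le_one₀ ht.2 (norm_nonneg l) hl1)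
      rw [← add_assoc] at h1
      have hx : δ ≤ ‖z.1 + k‖ := by
        have h2 := PiLp.norm_apply_le (z.1 + k) i
        have h3 : δ ≤ σ * (z.1 + k) i := by
          rw [PiLp.add_apply, mul_add]; linarith [hz.2]
        calc δ ≤ |σ * (z.1 + k) i| := h3.trans (le_abs_self _)
          _ = |(z.1 + k) i| := by rw [abs_mul, hσ, one_mul]
          _ ≤ _ := h2
      have hρ : δ ^ 2 ≤ ‖z.1 + k‖ ^ (2 * γ) := by
        calc δ ^ 2 = δ ^ (2 : ℝ) := by norm_cast
          _ ≤ δ ^ (2 * γ) := Real.rpow_le_rpow_of_exponent_ge hδ0 hδ1 (by linarith)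
          _ ≤ _ := Real.rpow_le_rpow hδ0.le hx (by linarith)
      set w := z + (k, (0 : EuclideanSpace ℝ (Fin m))) + t • ((0 : EuclideanSpace ℝ (Fin n)), l)
        with hwdef
      have hw1 : w.1 = z.1 + k := by simp [hwdef]
      rw [← hw1] at hρ
      calc fderiv ℝ f w (0, l) ^ 2 ≤ ‖l‖ ^ 2 * ∑ j, dY n m f w j ^ 2 :=
            fderiv_vertical_sq_le w l
        _ ≤ (δ ^ 2) ^ 2 * ∑ j, dY n m f w j ^ 2 := by gcongr
        _ = δ ^ 2 * (δ ^ 2 * ∑ j, dY n m f w j ^ 2) := by ring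
        _ ≤ δ ^ 2 * (‖w.1‖ ^ (2 * γ) * ∑ j, dY n m f w j ^ 2) := by gcongr
        _ ≤ δ ^ 2 * gradSqG n m γ f w := by
            gcongr
            exact le_add_of_nonneg_left (by positivity)
        _ ≤ δ ^ 2 * gradSqG n m γ f w * (M * Real.exp (-grushinT γ w ^ q)) :=
            le_mul_of_one_le_right (mul_nonneg (by positivity) (gradSqG_nonneg w)) h1
        _ = _ := by ring
  have i1 := (integrable_sq_sub_translate hfc hfs (0 + (k, 0)) 0).integrableOn (s := K)
  have i2 := (integrable_sq_sub_translate hfc hfs ((k, 0) + (0, l)) (k, 0)).integrableOn (s := K)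
  simp only [← add_assoc] at i1 i2
  have i3 : Integrable fun z => |f z| * Real.exp (-grushinT γ z ^ q) *
      (|f (z + (k, l))| * Real.exp (-grushinT γ (z + (k, l)) ^ q)) :=
    (ca.mul (ca.comp (by fun_prop))).integrable_of_hasCompactSupport sa.mul_right
  have i0 : Integrable fun z => f z ^ 2 :=
    (hfc.pow 2).integrable_of_hasCompactSupport (hfs.mono fun w hw h => hw (by simp [h]))
  have hle : ∀ z ∈ K, f z ^ 2 ≤ 2 * (f (z + 0 + (k, 0)) - f (z + 0)) ^ 2 +
      2 * (f (z + (k, 0) + (0, l)) - f (z + (k, 0))) ^ 2 +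
      2 * M ^ 2 * (|f z| * Real.exp (-grushinT γ z ^ q) *
        (|f (z + (k, l))| * Real.exp (-grushinT γ (z + (k, l)) ^ q))) := fun z hz => by
    have h0 := hw z hz 0 (by simp) (by simp)
    have h1 := hw z hz (k, l) (by simp; linarith)
      (hl.le.trans (pow_le_one₀ hδ0.le hδ1))
    have e : z + (k, (0 : EuclideanSpace ℝ (Fin m))) + (0, l) = z + (k, l) := by
      simp [add_assoc]
    rw [add_zero] at h0
    rw [add_zero, e]
    have h2 : |f z| * |f (z + (k, l))| ≤ |f z| * |f (z + (k, l))| *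
        ((M * Real.exp (-grushinT γ z ^ q)) * (M * Real.exp (-grushinT γ (z + (k, l)) ^ q))) :=
      le_mul_of_one_le_right (by positivity) (one_le_mul_of_one_le_of_one_le h0 h1)
    have h3 : f z * f (z + (k, l)) ≤ |f z| * |f (z + (k, l))| := by
      rw [← abs_mul]; exact le_abs_self _
    nlinarith [sq_nonneg (f (z + (k, l))),
      sq_nonneg ((f (z + (k, 0)) - f z) - (f (z + (k, l)) - f (z + (k, 0))))]
  have hfin := setIntegral_mono_on i0.integrableOn
    (((i1.const_mul 2).add (i2.const_mul 2)).add (i3.integrableOn.const_mul (2 * M ^ 2))) hK hle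
  rw [integral_add' ((i1.const_mul 2).add (i2.const_mul 2))
    (i3.integrableOn.const_mul (2 * M ^ 2)), integral_add' (i1.const_mul 2) (i2.const_mul 2),
    integral_const_mul, integral_const_mul, integral_const_mul] at hfin
  have h4 := setIntegral_le_integral (s := K) i3 (.of_forall fun z => by positivity)
  have h5 := mul_le_mul_of_nonneg_left (h4.trans hint) (by positivity : 0 ≤ 2 * M ^ 2)
  linarith

end Local

section Global

variable {n m : ℕ} {γ q τ : ℝ} {f : EuclideanSpace ℝ (Fin n) × EuclideanSpace ℝ (Fin m) → ℝ}

theorem grushin_local_bound (hγ0 : 0 ≤ γ) (hγ1 : γ < 1) (hq0 : 0 < q) (hq1 : q < 1)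
    (hτ : τ ≤ q) (hf : ContDiff ℝ 1 f) (hfs : HasCompactSupport f) (i : Fin n) {R : ℝ}
    (hR : 1 ≤ R) :
    ∫ z in {z | grushinT γ z ≤ R}, f z ^ 2 ≤
      40 * (R ^ τ)⁻¹ * (∫ w, gradSqG n m γ f w * Real.exp (-grushinT γ w ^ q)) +
      4 * (volume.real (Metric.ball (0 : EuclideanSpace ℝ (Fin n)) 1) *
          volume.real (Metric.ball (0 : EuclideanSpace ℝ (Fin m)) 1))⁻¹ *
        Real.exp (400 * (n + 2 * m + 2) * R ^ q) *
        (∫ w, |f w| * Real.exp (-grushinT γ w ^ q)) ^ 2 := by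
  have hfc := hf.continuous
  have i0 : Integrable fun z => f z ^ 2 :=
    (hfc.pow 2).integrable_of_hasCompactSupport (hfs.mono fun w hw h => hw (by simp [h]))
  have cσ : Continuous fun z : EuclideanSpace ℝ (Fin n) × EuclideanSpace ℝ (Fin m) => z.1 i := by
    fun_prop
  have hRq : 0 ≤ R ^ q := by positivity
  have hδ1 : Real.exp (-(400 * R ^ q)) ≤ 1 := Real.exp_le_one_iff.2 (by linarith)
  have b1 := halfSpace_local_bound hγ0 hγ1 hq0 hq1 hf hfs i hR (Real.exp_pos _) hδ1
    (σ := 1) (by simp)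
  have b2 := halfSpace_local_bound hγ0 hγ1 hq0 hq1 hf hfs i hR (Real.exp_pos _) hδ1
    (σ := -1) (by simp)
  have split := integral_inter_add_sdiff (μ := volume) (s := {z | grushinT γ z ≤ R})
    (t := {z | 0 ≤ z.1 i}) (f := fun z => f z ^ 2)
    (measurableSet_le measurable_const cσ.measurable) i0.integrableOn
  have e1 : {z : EuclideanSpace ℝ (Fin n) × EuclideanSpace ℝ (Fin m) | grushinT γ z ≤ R} ∩
      {z | 0 ≤ z.1 i} = {z | grushinT γ z ≤ R ∧ 0 ≤ 1 * z.1 i} := by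
    ext z; simp
  have e2 : ∫ z in {z : EuclideanSpace ℝ (Fin n) × EuclideanSpace ℝ (Fin m) |
      grushinT γ z ≤ R} \ {z | 0 ≤ z.1 i}, f z ^ 2 ≤
      ∫ z in {z | grushinT γ z ≤ R ∧ 0 ≤ -1 * z.1 i}, f z ^ 2 := by
    refine setIntegral_mono_set i0.integrableOn (.of_forall fun z => sq_nonneg _)
      (LE.le.eventuallyLE fun z hz => ?_)
    simp only [Set.mem_sdiff, Set.mem_ofPred_eq, not_le] at hz ⊢
    exact ⟨hz.1, by linarith [hz.2]⟩
  rw [e1] at split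
  have h1 : Real.exp (400 * R ^ q) * Real.exp (-(400 * R ^ q)) ^ 2 ≤ (R ^ τ)⁻¹ := by
    rw [sq, ← mul_assoc, ← Real.exp_add, add_neg_cancel, Real.exp_zero, one_mul, Real.exp_neg]
    refine inv_anti₀ (by positivity) ?_
    have := Real.rpow_le_rpow_of_exponent_le hR hτ
    linarith [Real.add_one_le_exp (400 * R ^ q)]
  have h2 : Real.exp (400 * R ^ q) ^ 2 * (Real.exp (-(400 * R ^ q)) ^ (n + 2 * m))⁻¹ =
      Real.exp (400 * (n + 2 * m + 2) * R ^ q) := by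
    rw [Real.exp_neg, inv_pow, inv_inv, ← pow_add, ← Real.exp_nat_mul]
    congr 1
    push_cast
    ring
  have hE : 0 ≤ ∫ w, gradSqG n m γ f w * Real.exp (-grushinT γ w ^ q) :=
    integral_nonneg fun w => mul_nonneg (gradSqG_nonneg w) (Real.exp_pos _).le
  have h3 := mul_le_mul_of_nonneg_right h1 hE
  rw [mul_inv] at b1 b2
  rw [← h2]
  linarith

theorem grushin_super_poincare_of_radius (hn : 1 ≤ n) (hγ0 : 0 ≤ γ) (hγ1 : γ < 1)
    (hq0 : 1 / 2 < q) (hq1 : q < 1) (hpq : q * (1 + γ) ≤ 1) (hτ : τ * (1 + γ) = 2 * q - 1)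
    (hf : ContDiff ℝ 1 f) (hfs : HasCompactSupport f) {R : ℝ} (hR : 1 ≤ R)
    (hRτ : 2 * (53 + 1680 * (3 * n + 4 * m)) ≤ R ^ τ) :
    ∫ w, f w ^ 2 * Real.exp (-grushinT γ w ^ q) ≤
      3472 * (R ^ τ)⁻¹ * (∫ w, gradSqG n m γ f w * Real.exp (-grushinT γ w ^ q)) +
      8 * (volume.real (Metric.ball (0 : EuclideanSpace ℝ (Fin n)) 1) *
          volume.real (Metric.ball (0 : EuclideanSpace ℝ (Fin m)) 1))⁻¹ *
        Real.exp (400 * (n + 2 * m + 2) * R ^ q) *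
        (∫ w, |f w| * Real.exp (-grushinT γ w ^ q)) ^ 2 := by
  have hqp : 0 < q := by linarith
  have hτ0 : 0 < τ := by
    by_contra! h
    nlinarith
  have hτq : τ ≤ q := by nlinarith
  have hloc := grushin_local_bound hγ0 hγ1 hqp hq1 hτq hf hfs ⟨0, hn⟩ hR
  have hmom := grushin_moment_bound hn hγ0 hγ1 hq0 hq1 hpq hτ hf hfs
  have hfc := hf.continuous
  have cW := continuous_exp_neg_grushinT (n := n) (m := m) (q := q) hγ0
  have cT := continuous_grushinT_rpow (n := n) (m := m) hγ0 τ
  have i0 : Integrable fun z => f z ^ 2 :=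
    (hfc.pow 2).integrable_of_hasCompactSupport (hfs.mono fun w hw h => hw (by simp [h]))
  have i1 : Integrable fun w => f w ^ 2 * Real.exp (-grushinT γ w ^ q) :=
    ((hfc.pow 2).mul cW).integrable_of_hasCompactSupport
      (hfs.mono fun w hw h => hw (by simp [h]))
  have i2 : Integrable fun w => f w ^ 2 * grushinT γ w ^ τ * Real.exp (-grushinT γ w ^ q) :=
    (((hfc.pow 2).mul cT).mul cW).integrable_of_hasCompactSupport
      (hfs.mono fun w hw h => hw (by simp [h]))
  have hKm : MeasurableSet {z : EuclideanSpace ℝ (Fin n) × EuclideanSpace ℝ (Fin m) |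
      grushinT γ z ≤ R} :=
    measurableSet_le continuous_grushinT.measurable measurable_const
  have hRp : 0 < R ^ τ := by positivity
  have hsplit : ∫ w, f w ^ 2 * Real.exp (-grushinT γ w ^ q) ≤
      (∫ z in {z | grushinT γ z ≤ R}, f z ^ 2) + (R ^ τ)⁻¹ *
        ∫ w, f w ^ 2 * grushinT γ w ^ τ * Real.exp (-grushinT γ w ^ q) := by
    rw [← integral_indicator hKm, ← integral_const_mul,
      ← integral_add (i0.indicator hKm) (i2.const_mul _)]
    refine integral_mono i1 ((i0.indicator hKm).add (i2.const_mul _)) fun w => ?_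
    simp only
    have hTp := grushinT_pos hγ0 w
    by_cases hw : grushinT γ w ≤ R
    · rw [Set.indicator_of_mem (by exact hw)]
      have h1 : Real.exp (-grushinT γ w ^ q) ≤ 1 :=
        Real.exp_le_one_iff.2 (by simp only [Left.neg_nonpos_iff]; positivity)
      have h2 := mul_le_mul_of_nonneg_left h1 (sq_nonneg (f w))
      have h3 : 0 ≤ (R ^ τ)⁻¹ * (f w ^ 2 * grushinT γ w ^ τ * Real.exp (-grushinT γ w ^ q)) := by
        positivity
      linarith
    · rw [Set.indicator_of_notMem (by exact hw), zero_add]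
      have h1 : 1 ≤ (R ^ τ)⁻¹ * grushinT γ w ^ τ := by
        rw [inv_mul_eq_div, one_le_div hRp]
        exact Real.rpow_le_rpow (by linarith) (not_le.1 hw).le hτ0.le
      calc _ ≤ f w ^ 2 * Real.exp (-grushinT γ w ^ q) * ((R ^ τ)⁻¹ * grushinT γ w ^ τ) :=
            le_mul_of_one_le_right (by positivity) h1
        _ = _ := by ring
  have hA : 0 ≤ ∫ w, f w ^ 2 * Real.exp (-grushinT γ w ^ q) :=
    integral_nonneg fun w => by positivity
  have hD : (R ^ τ)⁻¹ * (53 + 1680 * (3 * n + 4 * m)) ≤ 1 / 2 := by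
    rw [inv_mul_le_iff₀ hRp]; linarith
  have h1 := mul_le_mul_of_nonneg_left hmom (inv_nonneg.2 hRp.le)
  have h2 := mul_le_mul_of_nonneg_right hD hA
  linarith

theorem one_add_rpow_le {s a : ℝ} (hs : 0 ≤ s) (ha : 0 ≤ a) :
    (1 + s) ^ a ≤ 2 ^ a * (1 + s ^ a) := by
  have hsa : 0 ≤ s ^ a := by positivity
  have h2a : (0 : ℝ) ≤ 2 ^ a := by positivity
  rcases le_total s 1 with h | h
  · calc (1 + s) ^ a ≤ 2 ^ a := by gcongr; linarith
      _ ≤ _ := by nlinarith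
  · calc (1 + s) ^ a ≤ (2 * s) ^ a := by gcongr; linarith
      _ = 2 ^ a * s ^ a := Real.mul_rpow (by norm_num) hs
      _ ≤ _ := by nlinarith

theorem grushin_super_poincare_regularised (hn : 1 ≤ n) (hγ0 : 0 ≤ γ) (hγ1 : γ < 1)
    (hq0 : 1 / 2 < q) (hq1 : q < 1) (hpq : q * (1 + γ) ≤ 1) (hτ : τ * (1 + γ) = 2 * q - 1) :
    ∃ C > 0, ∀ ε > (0 : ℝ), ∀ f : EuclideanSpace ℝ (Fin n) × EuclideanSpace ℝ (Fin m) → ℝ,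
      ContDiff ℝ 1 f → HasCompactSupport f →
      ∫ w, f w ^ 2 * Real.exp (-grushinT γ w ^ q) ≤
        ε * (∫ w, gradSqG n m γ f w * Real.exp (-grushinT γ w ^ q)) +
        Real.exp (C * (1 + ε ^ (-(q / τ)))) *
          (∫ w, |f w| * Real.exp (-grushinT γ w ^ q)) ^ 2 := by
  have hτ0 : 0 < τ := by
    by_contra! h
    nlinarith
  have ha : 0 < q / τ := div_pos (by linarith) hτ0
  set v := 8 * (volume.real (Metric.ball (0 : EuclideanSpace ℝ (Fin n)) 1) *
          volume.real (Metric.ball (0 : EuclideanSpace ℝ (Fin m)) 1))⁻¹ with hv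
  have hv0 : 0 ≤ v := by positivity
  set L : ℝ := 2 * (53 + 1680 * (3 * n + 4 * m)) + 3472 with hL
  have hL1 : 3472 ≤ L := by
    rw [hL]
    exact le_add_of_nonneg_left (by positivity)
  refine ⟨v + 400 * (n + 2 * m + 2) * (L ^ (q / τ) * 2 ^ (q / τ)), by positivity,
    fun ε hε f hf hfs => ?_⟩
  have hs : 0 < ε⁻¹ := inv_pos.2 hε
  have hLs : L ≤ L * (1 + ε⁻¹) := le_mul_of_one_le_right (by linarith) (by linarith)
  have hLp : 0 < L * (1 + ε⁻¹) := by linarith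
  set R := (L * (1 + ε⁻¹)) ^ τ⁻¹ with hRdef
  have hR : 1 ≤ R := Real.one_le_rpow (by linarith) (by positivity)
  have hRτ : R ^ τ = L * (1 + ε⁻¹) := Real.rpow_inv_rpow hLp.le hτ0.ne'
  have hRq : R ^ q = (L * (1 + ε⁻¹)) ^ (q / τ) := by
    rw [hRdef, ← Real.rpow_mul hLp.le, inv_mul_eq_div]
  have hmain := grushin_super_poincare_of_radius hn hγ0 hγ1 hq0 hq1 hpq hτ hf hfs hR
    (by rw [hRτ]; linarith)
  refine hmain.trans (add_le_add ?_ ?_)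
  · refine mul_le_mul_of_nonneg_right ?_
      (integral_nonneg fun w => mul_nonneg (gradSqG_nonneg w) (Real.exp_pos _).le)
    rw [hRτ, mul_inv_le_iff₀ hLp]
    have : ε * (L * (1 + ε⁻¹)) = ε * L + L := by field_simp
    rw [this]
    nlinarith
  · refine mul_le_mul_of_nonneg_right ?_ (sq_nonneg _)
    have h1 : R ^ q ≤ L ^ (q / τ) * 2 ^ (q / τ) * (1 + ε ^ (-(q / τ))) := by
      rw [hRq, Real.mul_rpow (by linarith) (by linarith), Real.rpow_neg hε.le,
        ← Real.inv_rpow hε.le, mul_assoc]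
      exact mul_le_mul_of_nonneg_left (one_add_rpow_le hs.le ha.le) (by positivity)
    have h2 : v ≤ Real.exp v := by linarith [Real.add_one_le_exp v]
    have h3 : 0 ≤ ε ^ (-(q / τ)) := by positivity
    calc v * Real.exp (400 * (n + 2 * m + 2) * R ^ q)
        ≤ Real.exp v * Real.exp (400 * (n + 2 * m + 2) *
          (L ^ (q / τ) * 2 ^ (q / τ) * (1 + ε ^ (-(q / τ))))) := by gcongr
      _ ≤ _ := by
          rw [← Real.exp_add, Real.exp_le_exp]
          nlinarith [mul_nonneg hv0 h3]

end Global

section Transfer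

theorem add_rpow_add_rpow_le {q s t b : ℝ} (hq0 : 0 ≤ q) (hq1 : q ≤ 1) (hs : 0 ≤ s)
    (hst : s ≤ t) (hb : 0 ≤ b) : (t + b) ^ q + s ^ q ≤ t ^ q + (s + b) ^ q := by
  rcases eq_or_lt_of_le (show s ≤ t + b by linarith) with h | h
  · have ht : t = s := by linarith
    have hb0 : b = 0 := by linarith
    simp [ht, hb0]
  have hc := Real.concaveOn_rpow hq0 hq1
  have hd : 0 < t + b - s := by linarith
  have hd0 := hd.ne'
  have hl : 0 ≤ b / (t + b - s) := by positivity
  have hl1 : 0 ≤ (t - s) / (t + b - s) := div_nonneg (by linarith) hd.le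
  have hsum : b / (t + b - s) + (t - s) / (t + b - s) = 1 := by field_simp; ring
  have h1 := hc.2 (Set.mem_Ici.2 hs) (Set.mem_Ici.2 (show 0 ≤ t + b by linarith)) hl hl1 hsum
  have h2 := hc.2 (Set.mem_Ici.2 hs) (Set.mem_Ici.2 (show 0 ≤ t + b by linarith)) hl1 hl
    (by linarith)
  simp only [smul_eq_mul] at h1 h2
  have e1 : b / (t + b - s) * s + (t - s) / (t + b - s) * (t + b) = t := by field_simp; ring
  have e2 : (t - s) / (t + b - s) * s + b / (t + b - s) * (t + b) = s + b := by field_simp; ring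
  rw [e1] at h1
  rw [e2] at h2
  have h3 : (t + b) ^ q + s ^ q = (b / (t + b - s) + (t - s) / (t + b - s)) * (s ^ q + (t + b) ^ q)
    := by rw [hsum]; ring
  rw [h3]
  linarith

variable {n m : ℕ} {γ p : ℝ}

theorem GKaplan_rpow (w : EuclideanSpace ℝ (Fin n) × EuclideanSpace ℝ (Fin m)) :
    GKaplan n m γ w ^ p =
      ((‖w.1‖ ^ 2) ^ (1 + γ) + (1 + γ) ^ 2 * ‖w.2‖ ^ 2) ^ (p / (2 + 2 * γ)) := by
  unfold GKaplan
  rw [← Real.rpow_mul (by positivity), one_div_mul_eq_div, Real.rpow_mul (norm_nonneg w.1)]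
  norm_cast

theorem GKaplan_rpow_le_grushinT (hγ0 : 0 ≤ γ) (hp0 : 0 < p)
    (w : EuclideanSpace ℝ (Fin n) × EuclideanSpace ℝ (Fin m)) :
    GKaplan n m γ w ^ p ≤ grushinT γ w ^ (p / (2 + 2 * γ)) := by
  rw [GKaplan_rpow]
  unfold grushinT grushinX
  gcongr
  linarith

theorem grushinT_le_GKaplan_rpow_add_one (hγ0 : 0 ≤ γ) (hp0 : 0 < p) (hp2 : p ≤ 2)
    (w : EuclideanSpace ℝ (Fin n) × EuclideanSpace ℝ (Fin m)) :
    grushinT γ w ^ (p / (2 + 2 * γ)) ≤ GKaplan n m γ w ^ p + 1 := by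
  rw [GKaplan_rpow]
  unfold grushinT grushinX
  have hq1 : p / (2 + 2 * γ) ≤ 1 := by rw [div_le_one (by positivity)]; linarith
  have h1 := add_rpow_add_rpow_le (q := p / (2 + 2 * γ)) (by positivity) hq1
    (show 0 ≤ (‖w.1‖ ^ 2) ^ (1 + γ) by positivity)
    (show (‖w.1‖ ^ 2) ^ (1 + γ) ≤ (1 + ‖w.1‖ ^ 2) ^ (1 + γ) by gcongr; linarith)
    (show 0 ≤ (1 + γ) ^ 2 * ‖w.2‖ ^ 2 by positivity)
  have e : (1 + γ) * (p / (2 + 2 * γ)) = p / 2 := by field_simp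
  rw [← Real.rpow_mul (by positivity), ← Real.rpow_mul (by positivity), e] at h1
  have h2 := Real.rpow_add_le_add_rpow zero_le_one (sq_nonneg ‖w.1‖)
    (show 0 ≤ p / 2 by positivity) (by linarith)
  rw [Real.one_rpow] at h2
  linarith

theorem continuous_GKaplan_rpow (hγ0 : 0 ≤ γ) (hp0 : 0 < p) :
    Continuous fun w => GKaplan n m γ w ^ p := by
  simp only [GKaplan_rpow]
  refine Continuous.rpow_const ?_ fun _ => .inr (by positivity)
  refine .add (Continuous.rpow_const (by fun_prop) fun _ => .inr (by positivity)) (by fun_prop)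

theorem integral_muG (hγ0 : 0 ≤ γ) (hp0 : 0 < p)
    (g : EuclideanSpace ℝ (Fin n) × EuclideanSpace ℝ (Fin m) → ℝ) :
    ∫ w, g w ∂(muG n m γ p) =
      (∫ v : EuclideanSpace ℝ (Fin n) × EuclideanSpace ℝ (Fin m),
        Real.exp (-(GKaplan n m γ v) ^ p))⁻¹ *
      ∫ w, g w * Real.exp (-(GKaplan n m γ w) ^ p) := by
  have cK := continuous_GKaplan_rpow (n := n) (m := m) hγ0 hp0
  have hZ : 0 ≤ ∫ v : EuclideanSpace ℝ (Fin n) × EuclideanSpace ℝ (Fin m),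
      Real.exp (-(GKaplan n m γ v) ^ p) := integral_nonneg fun v => (Real.exp_pos _).le
  have hd : AEMeasurable fun w : EuclideanSpace ℝ (Fin n) × EuclideanSpace ℝ (Fin m) =>
      ENNReal.ofReal ((∫ v : EuclideanSpace ℝ (Fin n) × EuclideanSpace ℝ (Fin m),
        Real.exp (-(GKaplan n m γ v) ^ p))⁻¹ * Real.exp (-(GKaplan n m γ w) ^ p)) :=
    (ENNReal.continuous_ofReal.comp (by fun_prop)).aemeasurable
  unfold muG
  rw [integral_withDensity_eq_integral_toReal_smul₀ hd (.of_forall fun _ => ENNReal.ofReal_lt_top),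
    ← integral_const_mul]
  congr 1 with w
  rw [ENNReal.toReal_ofReal (by positivity), smul_eq_mul]
  ring

end Transfer

/-- The 2-super-Poincaré inequality in the Grushin setting for `dμ = Z⁻¹ e^{-N^p} dξ`,
`0 ≤ γ < 1`, `γ + 1 < p < 2`, with growth function
`β₂(ε) ∼ exp(C ε^{-p(γ+1)/(2(p-γ-1))})`:
`∫ f² dμ ≤ ε ∫ |∇_γ f|² dμ + exp(C(1 + ε^{-p(γ+1)/(2(p-γ-1))})) (∫ |f| dμ)²`. -/
theorem spi2_grushin (n m : ℕ) (hn : 1 ≤ n) (hm : 1 ≤ m) (γ p : ℝ)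
    (hγ0 : 0 ≤ γ) (hγ1 : γ < 1) (hp1 : γ + 1 < p) (hp2 : p < 2) :
    ∃ C > 0, ∀ ε > (0 : ℝ),
      ∀ f : EuclideanSpace ℝ (Fin n) × EuclideanSpace ℝ (Fin m) → ℝ,
      ContDiff ℝ (⊤ : ℕ∞) f → HasCompactSupport f →
      ∫ w, (f w) ^ 2 ∂(muG n m γ p) ≤
        ε * (∫ w, gradSqG n m γ f w ∂(muG n m γ p)) +
          Real.exp (C * (1 + ε ^ (-(p * (γ + 1) / (2 * (p - γ - 1)))))) *
            (∫ w, |f w| ∂(muG n m γ p)) ^ 2 := by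
  have hγ : 0 < 1 + γ := by linarith
  have hp0 : 0 < p := by linarith
  set q := p / (2 + 2 * γ) with hq
  set τ := (2 * q - 1) / (1 + γ) with hτ
  have hq0 : 1 / 2 < q := by rw [hq, lt_div_iff₀ (by positivity)]; linarith
  have hq1 : q < 1 := by rw [hq, div_lt_one (by positivity)]; linarith
  have hqγ : q * (1 + γ) = p / 2 := by rw [hq]; field_simp
  have haτ : q / τ = p * (γ + 1) / (2 * (p - γ - 1)) := by
    have h1 : p - γ - 1 ≠ 0 := by linarith
    have h2 : 2 * q - 1 = (p - γ - 1) / (1 + γ) := by rw [hq]; field_simp; ring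
    rw [hτ, h2, hq]
    field_simp
    ring
  obtain ⟨C, hC, hmain⟩ := grushin_super_poincare_regularised (n := n) (m := m) hn hγ0 hγ1 hq0 hq1
    (by rw [hqγ]; linarith) (div_mul_cancel₀ (2 * q - 1) hγ.ne' : τ * (1 + γ) = 2 * q - 1)
  rw [haτ] at hmain
  have ha : 0 < p * (γ + 1) / (2 * (p - γ - 1)) := div_pos (by nlinarith) (by linarith)
  generalize p * (γ + 1) / (2 * (p - γ - 1)) = a at hmain ha ⊢
  simp only [integral_muG hγ0 hp0]
  have hZ0 : 0 ≤ ∫ v : EuclideanSpace ℝ (Fin n) × EuclideanSpace ℝ (Fin m),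
      Real.exp (-(GKaplan n m γ v) ^ p) := integral_nonneg fun v => (Real.exp_pos _).le
  generalize ∫ v : EuclideanSpace ℝ (Fin n) × EuclideanSpace ℝ (Fin m),
      Real.exp (-(GKaplan n m γ v) ^ p) = Z at hZ0 ⊢
  refine ⟨Z + 1 + C * Real.exp 1 ^ a, by positivity, fun ε hε f hf hfs => ?_⟩
  have hf1 : ContDiff ℝ 1 f := hf.of_le (by exact_mod_cast le_top)
  have hfc := hf1.continuous
  have cg := continuous_gradSqG (n := n) (m := m) hγ0 hf1
  have cW := continuous_exp_neg_grushinT (n := n) (m := m) (q := q) hγ0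
  have cK := continuous_GKaplan_rpow (n := n) (m := m) hγ0 hp0
  have hlo : ∀ w, Real.exp (-grushinT γ w ^ q) ≤ Real.exp (-GKaplan n m γ w ^ p) := fun w =>
    Real.exp_le_exp.2 (neg_le_neg (GKaplan_rpow_le_grushinT hγ0 hp0 w))
  have hup : ∀ w, Real.exp (-GKaplan n m γ w ^ p) ≤
      Real.exp 1 * Real.exp (-grushinT γ w ^ q) := fun w => by
    rw [← Real.exp_add, Real.exp_le_exp]
    linarith [grushinT_le_GKaplan_rpow_add_one hγ0 hp0 hp2.le w]
  have hsupp : ∀ g h : EuclideanSpace ℝ (Fin n) × EuclideanSpace ℝ (Fin m) → ℝ,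
      Continuous g → HasCompactSupport g → Continuous h →
      Integrable fun w => g w * h w := fun g h hg hgs hh =>
    (hg.mul hh).integrable_of_hasCompactSupport hgs.mul_right
  have s1 : HasCompactSupport fun w => f w ^ 2 := hfs.mono fun w hw h => hw (by simp [h])
  have s2 : HasCompactSupport fun w => |f w| := hfs.mono fun w hw h => hw (by simp [h])
  have s3 := hasCompactSupport_gradSqG (γ := γ) hfs
  have hA : ∫ w, f w ^ 2 * Real.exp (-GKaplan n m γ w ^ p) ≤
      Real.exp 1 * ∫ w, f w ^ 2 * Real.exp (-grushinT γ w ^ q) := by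
    rw [← integral_const_mul]
    refine integral_mono (hsupp _ _ (by fun_prop) s1 (by fun_prop))
      ((hsupp _ _ (by fun_prop) s1 (by fun_prop)).const_mul _) fun w => ?_
    refine (mul_le_mul_of_nonneg_left (hup w) (sq_nonneg (f w))).trans_eq ?_
    ring
  have hB : ∫ w, |f w| * Real.exp (-grushinT γ w ^ q) ≤
      ∫ w, |f w| * Real.exp (-GKaplan n m γ w ^ p) :=
    integral_mono (hsupp _ _ (by fun_prop) s2 (by fun_prop))
      (hsupp _ _ (by fun_prop) s2 (by fun_prop))
      fun w => mul_le_mul_of_nonneg_left (hlo w) (abs_nonneg (f w))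
  have hB0 : 0 ≤ ∫ w, |f w| * Real.exp (-grushinT γ w ^ q) :=
    integral_nonneg fun w => by positivity
  have hE : ∫ w, gradSqG n m γ f w * Real.exp (-grushinT γ w ^ q) ≤
      ∫ w, gradSqG n m γ f w * Real.exp (-GKaplan n m γ w ^ p) :=
    integral_mono (hsupp _ _ cg s3 (by fun_prop)) (hsupp _ _ cg s3 (by fun_prop))
      fun w => mul_le_mul_of_nonneg_left (hlo w) (gradSqG_nonneg w)
  have key := hmain (ε / Real.exp 1) (by positivity) f hf1 hfs
  generalize ∫ w, f w ^ 2 * Real.exp (-GKaplan n m γ w ^ p) = A₁ at *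
  generalize ∫ w, f w ^ 2 * Real.exp (-grushinT γ w ^ q) = A₂ at *
  generalize ∫ w, |f w| * Real.exp (-GKaplan n m γ w ^ p) = B₁ at *
  generalize ∫ w, |f w| * Real.exp (-grushinT γ w ^ q) = B₂ at *
  generalize ∫ w, gradSqG n m γ f w * Real.exp (-GKaplan n m γ w ^ p) = E₁ at *
  generalize ∫ w, gradSqG n m γ f w * Real.exp (-grushinT γ w ^ q) = E₂ at *
  rcases hZ0.eq_or_lt with rfl | hZ
  · simp
  have hεa : (ε / Real.exp 1) ^ (-a) = Real.exp 1 ^ a * ε ^ (-a) := by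
    rw [Real.div_rpow hε.le (Real.exp_pos 1).le, Real.rpow_neg (Real.exp_pos 1).le,
      div_inv_eq_mul, mul_comm]
  rw [hεa] at key
  have hea : 1 ≤ Real.exp 1 ^ a := Real.one_le_rpow (Real.one_le_exp zero_le_one) ha.le
  have hs : 0 < ε ^ (-a) := by positivity
  have hexp : Z * (Real.exp 1 * Real.exp (C * (1 + Real.exp 1 ^ a * ε ^ (-a)))) ≤
      Real.exp ((Z + 1 + C * Real.exp 1 ^ a) * (1 + ε ^ (-a))) := by
    calc _ ≤ Real.exp Z * (Real.exp 1 * Real.exp (C * (1 + Real.exp 1 ^ a * ε ^ (-a)))) := by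
          gcongr
          linarith [Real.add_one_le_exp Z]
      _ ≤ _ := by
          rw [← Real.exp_add, ← Real.exp_add, Real.exp_le_exp]
          nlinarith [mul_le_mul_of_nonneg_left hea hC.le, mul_pos hZ hs]
  have h1 : A₁ ≤ ε * E₁ + Real.exp 1 * Real.exp (C * (1 + Real.exp 1 ^ a * ε ^ (-a))) * B₁ ^ 2 := by
    calc A₁ ≤ Real.exp 1 * A₂ := hA
      _ ≤ Real.exp 1 * (ε / Real.exp 1 * E₁ +
          Real.exp (C * (1 + Real.exp 1 ^ a * ε ^ (-a))) * B₁ ^ 2) := by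
          gcongr
          exact key.trans (by gcongr)
      _ = _ := by field_simp
  calc Z⁻¹ * A₁ ≤ Z⁻¹ * (ε * E₁ +
        Real.exp 1 * Real.exp (C * (1 + Real.exp 1 ^ a * ε ^ (-a))) * B₁ ^ 2) := by gcongr
    _ = ε * (Z⁻¹ * E₁) + Z * (Real.exp 1 * Real.exp (C * (1 + Real.exp 1 ^ a * ε ^ (-a)))) *
        (Z⁻¹ * B₁) ^ 2 := by field_simp
    _ ≤ _ := by gcongr
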